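/- arXiv:2506.19338 — 2 statements merged into one kernel-verified Lean document; each statement's English description precedes it below -/
import Mathlib

section
/- Let 0<p≤1, α>0, and let μ be a positive Borel measure on [0,1) which is a 1/p-Carleson measure. Then there exists a constant C>0 such that for every f(z)=Σ_{k≥0} a_k z^k in H^p and every n≥0, Σ_{k≥0} |μ_{n,k,α}| |a_k| ≤ C (Γ(n+α)/(n! Γ(α))) ‖f‖_{H^p}. -/
open MeasureTheory Complex Metric Filter Topology Set

noncomputable section

/-- The set of `p`-th circle means used to define the Hardy norm. -/
def hardySet (p : ℝ) (f : ℂ → ℂ) : Set ℝ :=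
  {y | ∃ r : ℝ, 0 < r ∧ r < 1 ∧
    y = ((2 * Real.pi)⁻¹ *
      ∫ θ in (0:ℝ)..(2 * Real.pi), ‖f ((r : ℂ) * Complex.exp (θ * Complex.I))‖ ^ p) ^ (1 / p)}

/-- The Hardy space norm `‖f‖_{H^p}`. -/
def hardyNorm (p : ℝ) (f : ℂ → ℂ) : ℝ := sSup (hardySet p f)

/-- Membership in the Hardy space `H^p` of the unit disk. -/
def MemHp (p : ℝ) (f : ℂ → ℂ) : Prop :=
  DifferentiableOn ℂ f (ball (0:ℂ) 1) ∧ BddAbove (hardySet p f)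

/-- The weighted Bergman norm `‖f‖_{A^q_β}` (normalized area measure `dA = (1/π) dx dy`). -/
def bergmanNorm (q β : ℝ) (f : ℂ → ℂ) : ℝ :=
  ((β + 1) * (Real.pi⁻¹ * ∫ z in ball (0:ℂ) 1, ‖f z‖ ^ q * (1 - ‖z‖ ^ 2) ^ β)) ^ (1 / q)

/-- Membership in the weighted Bergman space `A^q_β`. -/
def MemBergman (q β : ℝ) (f : ℂ → ℂ) : Prop :=
  DifferentiableOn ℂ f (ball (0:ℂ) 1) ∧
  IntegrableOn (fun z : ℂ => ‖f z‖ ^ q * (1 - ‖z‖ ^ 2) ^ β) (ball (0:ℂ) 1)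

/-- The set of values `(1-|z|²)|f'(z)|` used to define the Bloch norm. -/
def blochSet (f : ℂ → ℂ) : Set ℝ :=
  {y | ∃ z : ℂ, ‖z‖ < 1 ∧ y = (1 - ‖z‖ ^ 2) * ‖deriv f z‖}

/-- The Bloch norm `‖f‖_ℬ = |f(0)| + sup_{z∈𝔻}(1-|z|²)|f'(z)|`. -/
def blochNorm (f : ℂ → ℂ) : ℝ := ‖f 0‖ + sSup (blochSet f)

/-- Membership in the Bloch space `ℬ`. -/
def MemBloch (f : ℂ → ℂ) : Prop :=
  DifferentiableOn ℂ f (ball (0:ℂ) 1) ∧ BddAbove (blochSet f)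

/-- `μ` is an `s`-Carleson measure on `[0,1)`. -/
def IsCarleson (μ : Measure ℝ) (s : ℝ) : Prop :=
  ∃ C > 0, ∀ t : ℝ, 0 ≤ t → t < 1 → (μ (Ico t 1)).toReal ≤ C * (1 - t) ^ s

/-- `μ` is a vanishing `s`-Carleson measure on `[0,1)`. -/
def IsVanishingCarleson (μ : Measure ℝ) (s : ℝ) : Prop :=
  Tendsto (fun t : ℝ => (μ (Ico t 1)).toReal / (1 - t) ^ s) (𝓝[<] (1:ℝ)) (𝓝 0)

/-- `μ` is a 1-logarithmic `s`-Carleson measure on `[0,1)`. -/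
def IsLogCarleson (μ : Measure ℝ) (s : ℝ) : Prop :=
  ∃ C > 0, ∀ t : ℝ, 0 ≤ t → t < 1 →
    Real.log (2 / (1 - t)) * (μ (Ico t 1)).toReal ≤ C * (1 - t) ^ s

/-- `μ` is a vanishing 1-logarithmic `s`-Carleson measure on `[0,1)`. -/
def IsVanishingLogCarleson (μ : Measure ℝ) (s : ℝ) : Prop :=
  Tendsto (fun t : ℝ => Real.log (2 / (1 - t)) * (μ (Ico t 1)).toReal / (1 - t) ^ s)
    (𝓝[<] (1:ℝ)) (𝓝 0)

/-- Condition (T1) for the exponent `p`: `μ` is a `1/p`-Carleson measure when `p ≤ 1`,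
and a 1-Carleson measure when `p > 1`. -/
def CondT1 (p : ℝ) (μ : Measure ℝ) : Prop :=
  (p ≤ 1 → IsCarleson μ (1 / p)) ∧ (1 < p → IsCarleson μ 1)

/-- The entries `μ_{n,k,α} = (Γ(n+α)/(n! Γ(α))) ∫_{[0,1)} t^{n+k} dμ(t)` of the
generalized Hankel matrix. -/
def muCoef (μ : Measure ℝ) (α : ℝ) (n k : ℕ) : ℝ :=
  (Real.Gamma (n + α) / (n.factorial * Real.Gamma α)) * ∫ t in Ico (0:ℝ) 1, t ^ (n + k) ∂μ

/-- The `k`-th Taylor coefficient of `f` at the origin. -/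
def taylorCoeff (f : ℂ → ℂ) (k : ℕ) : ℂ := iteratedDeriv k f 0 / (k.factorial : ℂ)

/-- The generalized Hilbert operator
`𝓗_{μ,α}(f)(z) = Σ_n (Σ_k μ_{n,k,α} a_k) z^n`, where `a_k` are the Taylor
coefficients of `f`. -/
def Hop (μ : Measure ℝ) (α : ℝ) (f : ℂ → ℂ) : ℂ → ℂ :=
  fun z => ∑' n : ℕ, (∑' k : ℕ, (muCoef μ α n k : ℂ) * taylorCoeff f k) * z ^ n

/-- The generalized integral Hilbert operator
`𝓘_{μ,α}(f)(z) = ∫_{[0,1)} f(t)/(1-tz)^α dμ(t)`. -/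
def Iop (μ : Measure ℝ) (α : ℝ) (f : ℂ → ℂ) : ℂ → ℂ :=
  fun z => ∫ t in Ico (0:ℝ) 1, f (t : ℂ) / (1 - (t : ℂ) * z) ^ (α : ℂ) ∂μ

/-- `𝓗_{μ,α}` is a bounded operator from `H^p` into `A^q_{α-2}`. -/
def BoundedHpToBergman (μ : Measure ℝ) (α p q : ℝ) : Prop :=
  (∀ f : ℂ → ℂ, MemHp p f → MemBergman q (α - 2) (Hop μ α f)) ∧
  ∃ C > 0, ∀ f : ℂ → ℂ, MemHp p f →
    bergmanNorm q (α - 2) (Hop μ α f) ≤ C * hardyNorm p f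

/-- `𝓗_{μ,α}` is a compact operator from `H^p` into `A^q_{α-2}`: it is bounded and the
image of every `H^p`-norm-bounded sequence has a subsequence converging in the
`A^q_{α-2}`-norm. -/
def CompactHpToBergman (μ : Measure ℝ) (α p q : ℝ) : Prop :=
  BoundedHpToBergman μ α p q ∧
  ∀ F : ℕ → ℂ → ℂ, (∀ n, MemHp p (F n)) → (∃ M, ∀ n, hardyNorm p (F n) ≤ M) →
    ∃ (φ : ℕ → ℕ) (g : ℂ → ℂ), StrictMono φ ∧ MemBergman q (α - 2) g ∧
      Tendsto (fun n => bergmanNorm q (α - 2) (fun z => Hop μ α (F (φ n)) z - g z))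
        atTop (𝓝 0)

/-- `𝓗_{μ,α}` is a bounded operator from `H^p` into the Bloch space `ℬ`. -/
def BoundedHpToBloch (μ : Measure ℝ) (α p : ℝ) : Prop :=
  (∀ f : ℂ → ℂ, MemHp p f → MemBloch (Hop μ α f)) ∧
  ∃ C > 0, ∀ f : ℂ → ℂ, MemHp p f → blochNorm (Hop μ α f) ≤ C * hardyNorm p f

/-- `𝓗_{μ,α}` is a compact operator from `H^p` into the Bloch space `ℬ`. -/
def CompactHpToBloch (μ : Measure ℝ) (α p : ℝ) : Prop :=
  BoundedHpToBloch μ α p ∧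
  ∀ F : ℕ → ℂ → ℂ, (∀ n, MemHp p (F n)) → (∃ M, ∀ n, hardyNorm p (F n) ≤ M) →
    ∃ (φ : ℕ → ℕ) (g : ℂ → ℂ), StrictMono φ ∧ MemBloch g ∧
      Tendsto (fun n => blochNorm (fun z => Hop μ α (F (φ n)) z - g z)) atTop (𝓝 0)


lemma s15_beta (k : ℕ) : ∑ x ∈ Finset.HasAntidiagonal.antidiagonal k,
    (1/(√((x.1:ℝ)+1) * √((x.2:ℝ)+1))) ≤ 4 := by
  have hs : ∀ n : ℕ, ∑ i ∈ Finset.range n, 1/√((i:ℝ)+1) ≤ 2 * √(n:ℝ) := by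
    intro n
    induction n with
    | zero => simp
    | succ n ih =>
      rw [Finset.sum_range_succ]
      push_cast
      have h1 : 0 < √((n:ℝ)+1) := by positivity
      have h2 := Real.sq_sqrt (show (0:ℝ) ≤ n by positivity)
      have h3 := Real.sq_sqrt (show (0:ℝ) ≤ (n:ℝ)+1 by positivity)
      have h4 := Real.sqrt_nonneg (n:ℝ)
      have : 1/√((n:ℝ)+1) ≤ 2*√((n:ℝ)+1) - 2 * √(n:ℝ) := by
        rw [div_le_iff₀ h1]
        nlinarith [sq_nonneg (√((n:ℝ)+1) - √(n:ℝ))]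
      linarith
  have hm : 0 < √((k:ℝ)+2) := by positivity
  have key : ∀ x ∈ Finset.HasAntidiagonal.antidiagonal k, (1/(√((x.1:ℝ)+1) * √((x.2:ℝ)+1))) ≤
      (1/√((x.1:ℝ)+1) + 1/√((x.2:ℝ)+1)) / √((k:ℝ)+2) := by
    rintro ⟨i, j⟩ hx
    have hij : i + j = k := by simpa using hx
    subst hij
    have h1 : 0 < √((i:ℝ)+1) := by positivity
    have h2 : 0 < √((j:ℝ)+1) := by positivity
    have h3 : √(((i+j:ℕ):ℝ)+2) ≤ √((i:ℝ)+1) + √((j:ℝ)+1) := by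
      rw [Real.sqrt_le_left (by positivity)]
      have := Real.sq_sqrt (show (0:ℝ) ≤ (i:ℝ)+1 by positivity)
      have := Real.sq_sqrt (show (0:ℝ) ≤ (j:ℝ)+1 by positivity)
      push_cast
      nlinarith
    rw [le_div_iff₀ hm]
    simp only
    rw [div_add_div _ _ h1.ne' h2.ne', div_mul_eq_mul_div]
    gcongr
    linarith
  refine (Finset.sum_le_sum key).trans ?_
  rw [← Finset.sum_div, div_le_iff₀ hm, Finset.sum_add_distrib]
  have e1 : ∑ x ∈ Finset.HasAntidiagonal.antidiagonal k, 1/√((x.1:ℝ)+1) = ∑ i ∈ Finset.range (k+1), 1/√((i:ℝ)+1) := by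
    rw [Finset.Nat.sum_antidiagonal_eq_sum_range_succ_mk]
  have e2 : ∑ x ∈ Finset.HasAntidiagonal.antidiagonal k, 1/√((x.2:ℝ)+1) = ∑ i ∈ Finset.range (k+1), 1/√((i:ℝ)+1) := by
    rw [← e1, ← Finset.Nat.sum_antidiagonal_swap]; rfl
  rw [e1, e2]
  have := hs (k+1)
  have h5 : √((k+1:ℕ):ℝ) ≤ √((k:ℝ)+2) := Real.sqrt_le_sqrt (by push_cast; linarith)
  linarith

lemma s15_geo (k J : ℕ) : ∑ j ∈ Finset.range J,
    ((1/2:ℝ)^j * √((k:ℝ)+1) * (1 - (1/4:ℝ)^(j+1))^k) ≤ 12 := by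
  set T : ℕ → ℝ := fun j => √((k:ℝ)+1) * (1/2)^j with hT
  have hTpos : ∀ j, 0 < T j := fun j => by simp only [hT]; positivity
  have hstep : ∀ j, T j = 2 * T (j+1) := fun j => by simp only [hT, pow_succ]; ring
  have key : ∀ j, ((1/2:ℝ)^j * √((k:ℝ)+1) * (1 - (1/4:ℝ)^(j+1))^k) ≤
      12 * (T j / (1 + T j) - T (j+1) / (1 + T (j+1))) := by
    intro j
    have ht := hTpos (j+1)
    set t := T (j+1) with htd
    set x := (1/4:ℝ)^(j+1) with hx
    have hx0 : 0 ≤ x := by positivity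
    have hx1 : x ≤ 1 := pow_le_one₀ (by norm_num) (by norm_num)
    have ht2 : t^2 = (k+1) * x := by
      simp only [htd, hT, hx]
      rw [mul_pow, Real.sq_sqrt (by positivity), ← pow_mul, mul_comm (j+1) 2, pow_mul]
      norm_num
    have e : (1/2:ℝ)^j * √((k:ℝ)+1) = 2 * t := by rw [← hstep]; simp only [hT]; ring
    rw [e, hstep j]
    have hq0 : 0 ≤ (1-x)^k := pow_nonneg (by linarith) _
    have hq1 : (1-x)^k ≤ 1 := pow_le_one₀ (by linarith) (by linarith)
    have hq2 : (1-x)^k * t^2 ≤ 1 := by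
      have h1 : 1 + (k:ℝ) * x ≤ (1+x)^k := one_add_mul_le_pow (by linarith) k
      have h2 : (1-x)^k * (1+x)^k ≤ 1 := by
        rw [← mul_pow]
        apply pow_le_one₀ <;> nlinarith
      have h3 : t^2 ≤ (1+x)^k := by rw [ht2]; linarith
      nlinarith
    have : 2 * t / (1 + 2 * t) - t / (1+t) = t / ((1+2*t)*(1+t)) := by
      field_simp; ring
    change 2 * t * (1-x)^k ≤ 12 * (2 * t / (1 + 2 * t) - t / (1+t))
    rw [this, ← mul_div_assoc, le_div_iff₀ (by positivity)]
    have h3 : (1-x)^k * ((1+2*t)*(1+t)) ≤ 6 := by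
      nlinarith [mul_nonneg hq0 (sq_nonneg (t-1))]
    nlinarith
  refine (Finset.sum_le_sum (fun j _ => key j)).trans ?_
  rw [← Finset.mul_sum, Finset.sum_range_sub' (fun j => T j / (1 + T j))]
  have h0 := hTpos 0
  have hJ := hTpos J
  have : T 0 / (1 + T 0) ≤ 1 := by rw [div_le_one (by linarith)]; linarith
  have : 0 ≤ T J / (1 + T J) := by positivity
  linarith

/-- Parseval -/
lemma s15_parseval (c : ℕ → ℂ) (hc : Summable fun k => ‖c k‖) (g : ℂ → ℂ)
    (hg : ∀ z : ℂ, ‖z‖ = 1 → HasSum (fun k => c k * z ^ k) (g z)) :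
    HasSum (fun k => ‖c k‖ ^ 2) (Real.circleAverage (fun z => ‖g z‖^2) 0 1) := by
  have : Fact (0 < 2 * Real.pi) := ⟨Real.two_pi_pos⟩
  have hsum : Summable (fun k : ℕ => c k • (fourier (k:ℤ) : C(AddCircle (2*Real.pi), ℂ))) := by
    apply Summable.of_norm
    simpa [norm_smul, fourier_norm] using hc
  obtain ⟨Φ, hΦ⟩ := hsum
  have hL := hΦ.mapL (ContinuousMap.toLp 2 AddCircle.haarAddCircle ℂ)
  set v := (ContinuousMap.toLp (E := ℂ) 2 (AddCircle.haarAddCircle (T := 2*Real.pi)) ℂ) Φ with hv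
  have hcoef : ∀ i : ℤ, HasSum (fun k : ℕ => if (k:ℤ) = i then c k else 0) (fourierCoeff v i) := by
    intro i
    have h1 := hL.mapL (innerSL ℂ (fourierLp (T := 2*Real.pi) 2 i))
    have h2 : fourierCoeff v i = inner ℂ (fourierLp (T := 2*Real.pi) 2 i) v := by
      rw [← fourierBasis_repr, HilbertBasis.repr_apply_apply, coe_fourierBasis]
    rw [h2]
    refine (show (fun k : ℕ => if (k:ℤ) = i then c k else 0) = _ from funext fun k => ?_) ▸ h1
    have horth := (orthonormal_iff_ite.1 (orthonormal_fourier (T := 2*Real.pi))) i (k:ℤ)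
    simp only [map_smul, innerSL_apply_apply]
    change _ = c k • inner ℂ (fourierLp 2 i) (fourierLp 2 (k:ℤ))
    rw [horth]
    by_cases h : (k:ℤ) = i
    · simp [h]
    · simp [h, Ne.symm h]
  have hP := hasSum_sq_fourierCoeff v
  have hnat : ∀ k : ℕ, fourierCoeff v (k:ℤ) = c k := by
    intro k
    have := (hcoef k).unique (hasSum_single k (fun m hm => by simp [hm]))
    simpa using this
  have hneg : ∀ i : ℤ, i ∉ Set.range (fun k : ℕ => (k:ℤ)) → ‖fourierCoeff v i‖^2 = 0 := by
    intro i hi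
    have : fourierCoeff v i = 0 := (hcoef i).unique (by
      convert hasSum_zero using 2 with k
      simp only [ite_eq_right_iff]
      intro h; exact absurd ⟨k, h⟩ hi)
    simp [this]
  rw [← (Nat.cast_injective (R := ℤ)).hasSum_iff hneg] at hP
  have h1 : ∫ (t : AddCircle (2 * Real.pi)), ‖Φ t‖ ^ 2 ∂AddCircle.haarAddCircle =
      ∫ (t : AddCircle (2 * Real.pi)), ‖v t‖ ^ 2 ∂AddCircle.haarAddCircle := by
    refine integral_congr_ae ?_
    filter_upwards [ContinuousMap.coeFn_toLp (p := 2) (𝕜 := ℂ) (AddCircle.haarAddCircle (T := 2*Real.pi)) Φ] with t ht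
    rw [← ht]
  rw [← h1, AddCircle.integral_haarAddCircle, ← AddCircle.intervalIntegral_preimage (2 * Real.pi) 0] at hP
  convert hP using 1
  · ext k; simp [hnat]
  · rw [Real.circleAverage, zero_add]
    congr 1
    refine intervalIntegral.integral_congr (fun θ _ => ?_)
    have h2 : HasSum (fun k : ℕ => (c k • (fourier (k:ℤ) : C(AddCircle (2*Real.pi), ℂ))) (θ : AddCircle (2*Real.pi))) (Φ θ) :=
      hΦ.mapL (ContinuousMap.evalCLM ℂ (θ : AddCircle (2*Real.pi)))
    have h3 := hg (circleMap 0 1 θ) (by simp)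
    have : g (circleMap 0 1 θ) = Φ θ := by
      refine h3.unique ?_
      convert h2 using 2 with k
      simp only [ContinuousMap.smul_apply, smul_eq_mul, fourier_coe_apply, circleMap]
      congr 1
      rw [zero_add, Complex.ofReal_one, one_mul, ← Complex.exp_nat_mul]
      congr 1
      have : (Real.pi : ℂ) ≠ 0 := by exact_mod_cast Real.pi_ne_zero
      push_cast
      field_simp
    simp only [this]

lemma s15_series (F : ℂ → ℂ) (hF : AnalyticOnNhd ℂ F (closedBall 0 1)) :
    ∃ b : ℕ → ℂ, Summable (fun k => ‖b k‖) ∧ ∀ z : ℂ, ‖z‖ ≤ 1 → HasSum (fun k => b k * z ^ k) (F z) := by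
  have hop : IsOpen {z | AnalyticAt ℂ F z} := isOpen_analyticAt ℂ F
  obtain ⟨δ, hδ, hsub⟩ := (isCompact_closedBall (0:ℂ) 1).exists_thickening_subset_open hop hF
  rw [thickening_closedBall hδ zero_le_one] at hsub
  have hd : DifferentiableOn ℂ F (ball 0 (δ+1)) := fun z hz => (hsub hz).differentiableAt.differentiableWithinAt
  have hs := fun z hz => Complex.hasSum_taylorSeries_on_ball (r := δ+1) hd (z := z) hz
  refine ⟨fun k => (k.factorial : ℂ)⁻¹ * iteratedDeriv k F 0, ?_, ?_⟩
  · have := (hs 1 (by simpa using hδ)).summable.norm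
    simpa using this
  · intro z hz
    have := hs z (by simp; change ‖z‖ < δ + 1; linarith)
    refine (show (fun k : ℕ => ((k.factorial : ℂ)⁻¹ * iteratedDeriv k F 0) * z ^ k) = _ from
      funext fun k => ?_) ▸ this
    simp only [sub_zero, smul_eq_mul]; ring


lemma s15_factor (h : ℂ → ℂ) (hh : AnalyticOnNhd ℂ h (closedBall 0 1))
    (hne : ∀ z : ℂ, ‖z‖ = 1 → h z ≠ 0) :
    ∃ G : ℂ → ℂ, AnalyticOnNhd ℂ G (closedBall 0 1) ∧ (∀ z : ℂ, ‖z‖ ≤ 1 → G z ≠ 0) ∧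
      (∀ z : ℂ, ‖z‖ ≤ 1 → ‖h z‖ ≤ ‖G z‖) ∧ (∀ z : ℂ, ‖z‖ = 1 → ‖h z‖ = ‖G z‖) := by
  have hm : MeromorphicOn h (closedBall 0 1) := hh.meromorphicOn
  have hconn : IsConnected (closedBall (0:ℂ) 1) :=
    ⟨⟨0, by simp⟩, (convex_closedBall (0:ℂ) 1).isPreconnected⟩
  have hord : ∀ u : closedBall (0:ℂ) 1, meromorphicOrderAt h u ≠ ⊤ := by
    rw [← hm.exists_meromorphicOrderAt_ne_top_iff_forall hconn]
    refine ⟨⟨1, by simp⟩, ?_⟩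
    have h1 : AnalyticAt ℂ h 1 := hh 1 (by simp)
    rw [h1.meromorphicOrderAt_eq, (h1.analyticOrderAt_eq_zero).2 (hne 1 (by simp))]
    simp
  set D := MeromorphicOn.divisor h (closedBall (0:ℂ) 1) with hD
  have hfin : D.support.Finite := D.finiteSupport (isCompact_closedBall 0 1)
  have hD0 : 0 ≤ D := MeromorphicOn.AnalyticOnNhd.divisor_nonneg hh
  obtain ⟨g, hg, hg0, heq⟩ := hm.extract_zeros_poles hord hfin
  rw [← hD] at heq
  set S := hfin.toFinset with hS
  set n : ℂ → ℕ := fun u => (D u).toNat with hn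
  have hnD : ∀ u, (n u : ℤ) = D u := fun u => Int.toNat_of_nonneg (hD0 u)
  have hprod : (∏ᶠ u, ((· - u) : ℂ → ℂ) ^ D u) = fun z => ∏ u ∈ S, (z - u) ^ n u := by
    rw [finprod_eq_prod_of_mulSupport_subset (s := S)]
    · ext z
      simp only [Finset.prod_apply, Pi.pow_apply, ← hnD, zpow_natCast]
    · intro u hu
      rw [hS, Finite.coe_toFinset]
      intro h0
      apply hu
      simp only [h0, zpow_zero]
  rw [hprod] at heq
  have hP : Continuous (fun z : ℂ => ∏ u ∈ S, (z - u) ^ n u) := by fun_prop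
  have hEq : ∀ z : ℂ, ‖z‖ ≤ 1 → h z = (∏ u ∈ S, (z - u) ^ n u) * g z := by
    intro z hz
    have hzU : z ∈ closedBall (0:ℂ) 1 := by simpa using hz
    have h1 : ∀ᶠ y in 𝓝[closedBall (0:ℂ) 1 \ {z}] z, h y = (∏ u ∈ S, (y - u) ^ n u) * g y := by
      have := (mem_codiscreteWithin_iff_forall_mem_nhdsNE.1 heq) z hzU
      have h2 : 𝓝[closedBall (0:ℂ) 1 \ {z}] z ≤ 𝓝[≠] z := nhdsWithin_mono _ (fun y hy => hy.2)
      filter_upwards [h2 this, self_mem_nhdsWithin] with y hy1 hy2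
      rcases hy1 with hy1 | hy1
      · exact hy1
      · exact absurd hy2.1 hy1
    have hnb : (𝓝[closedBall (0:ℂ) 1 \ {z}] z).NeBot := by
      rw [← accPt_principal_iff_nhdsWithin]
      exact (convex_closedBall (0:ℂ) 1).isPreconnected.preperfect_of_nontrivial ⟨0, by simp, 1, by simp, by simp⟩ z hzU
    have t1 : Tendsto h (𝓝[closedBall (0:ℂ) 1 \ {z}] z) (𝓝 (h z)) :=
      (hh z hzU).continuousAt.tendsto.mono_left nhdsWithin_le_nhds
    have t2 : Tendsto (fun y => (∏ u ∈ S, (y - u) ^ n u) * g y) (𝓝[closedBall (0:ℂ) 1 \ {z}] z)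
        (𝓝 ((∏ u ∈ S, (z - u) ^ n u) * g z)) :=
      (hP.continuousAt.mul (hg z hzU).continuousAt).tendsto.mono_left nhdsWithin_le_nhds
    exact tendsto_nhds_unique (t1.congr' h1) t2
  have hSlt : ∀ u ∈ S, ‖u‖ < 1 := by
    intro u hu
    have hu' : D u ≠ 0 := by simpa [hS] using hu
    have huU : ‖u‖ ≤ 1 := by
      by_contra hcon
      exact hu' (D.apply_eq_zero_of_notMem (by simpa using hcon))
    refine lt_of_le_of_ne huU fun h1 => hne u h1 ?_
    rw [hEq u huU, Finset.prod_eq_zero hu, zero_mul]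
    rw [sub_self, zero_pow]
    intro h0; apply hu'; rw [← hnD, h0]; rfl
  have key : ∀ u z : ℂ, ‖1 - (starRingEnd ℂ) u * z‖^2 - ‖z - u‖^2 = (1 - ‖u‖^2) * (1-‖z‖^2) := by
    intro u z
    simp only [← Complex.normSq_eq_norm_sq, Complex.normSq_apply]
    simp; ring
  refine ⟨fun z => (∏ u ∈ S, (1 - (starRingEnd ℂ) u * z) ^ n u) * g z, ?_, ?_, ?_, ?_⟩
  · intro z hz
    refine AnalyticAt.mul ?_ (hg z hz)
    refine Differentiable.analyticAt (fun z => ?_) z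
    fun_prop
  · intro z hz
    refine mul_ne_zero (Finset.prod_ne_zero_iff.2 fun u hu => pow_ne_zero _ ?_) (hg0 ⟨z, by simpa using hz⟩)
    intro h0
    have h1 : (starRingEnd ℂ) u * z = 1 := (sub_eq_zero.1 h0).symm
    have h2 : ‖u‖ * ‖z‖ = 1 := by rw [← Complex.norm_conj u, ← norm_mul, h1, norm_one]
    nlinarith [hSlt u hu, norm_nonneg u, norm_nonneg z]
  · intro z hz
    rw [hEq z hz, norm_mul, norm_mul, norm_prod, norm_prod]
    gcongr with u hu
    rw [norm_pow, norm_pow]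
    gcongr
    refine le_of_sq_le_sq ?_ (norm_nonneg _)
    have h1 := hSlt u hu
    have : 0 ≤ (1 - ‖u‖^2) * (1-‖z‖^2) := mul_nonneg (by nlinarith [norm_nonneg u]) (by nlinarith [norm_nonneg z])
    linarith [key u z]
  · intro z hz
    rw [hEq z hz.le, norm_mul, norm_mul, norm_prod, norm_prod]
    congr 1
    refine Finset.prod_congr rfl fun u hu => ?_
    rw [norm_pow, norm_pow]
    congr 1
    rw [← sq_eq_sq₀ (norm_nonneg _) (norm_nonneg _)]
    have := key u z
    rw [hz] at this
    linarith

lemma s15_root (G : ℂ → ℂ) (hG : AnalyticOnNhd ℂ G (closedBall 0 1))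
    (hne : ∀ z : ℂ, ‖z‖ ≤ 1 → G z ≠ 0) (s : ℝ) :
    ∃ F : ℂ → ℂ, AnalyticOnNhd ℂ F (closedBall 0 1) ∧ ∀ z : ℂ, ‖z‖ ≤ 1 → ‖F z‖ = ‖G z‖ ^ s := by
  have hop : IsOpen ({z | AnalyticAt ℂ G z} ∩ {z | AnalyticAt ℂ G z ∧ G z ≠ 0}) := by
    rw [isOpen_iff_mem_nhds]
    rintro z ⟨h1, -, h2⟩
    filter_upwards [h1.eventually_analyticAt, h1.continuousAt.eventually_ne h2] with y a b
    exact ⟨a, a, b⟩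
  obtain ⟨δ, hδ, hsub⟩ := (isCompact_closedBall (0:ℂ) 1).exists_thickening_subset_open hop
    (fun z hz => ⟨hG z hz, hG z hz, hne z (by simpa using hz)⟩)
  rw [thickening_closedBall hδ zero_le_one] at hsub
  have hd : DifferentiableOn ℂ (fun z => deriv G z / G z) (ball 0 (δ+1)) := fun z hz =>
    ((hsub hz).1.deriv.differentiableAt.div (hsub hz).1.differentiableAt (hsub hz).2.2).differentiableWithinAt
  obtain ⟨Lg, hL0, hL⟩ := hd.isExactOn_ball.with_val_at 0 (Complex.log (G 0))
  have h00 : (0:ℂ) ∈ ball (0:ℂ) (δ+1) := by simp; linarith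
  have hexp : ∀ z ∈ ball (0:ℂ) (δ+1), G z = Complex.exp (Lg z) := by
    have hc : ∀ z ∈ ball (0:ℂ) (δ+1), G z * Complex.exp (-Lg z) = G 0 * Complex.exp (-Lg 0) := by
      intro z hz
      refine (convex_ball (0:ℂ) (δ+1)).is_const_of_fderivWithin_eq_zero (𝕜 := ℂ) (f := fun z => G z * Complex.exp (-Lg z)) ?_ ?_ hz h00
      · intro w hw
        exact ((hsub hw).1.differentiableAt.mul (hL w hw).differentiableAt.neg.cexp).differentiableWithinAt
      · intro w hw
        rw [fderivWithin_of_isOpen isOpen_ball hw]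
        have h1 := (hsub hw).1.differentiableAt.hasDerivAt.mul ((hL w hw).neg.cexp)
        have h2 : HasDerivAt (fun z => G z * Complex.exp (-Lg z)) 0 w := by
          have := (hsub hw).2.2
          have e : deriv G w / G w * G w = deriv G w := div_mul_cancel₀ _ this
          have e2 : deriv G w * Complex.exp (-Lg w) + G w * (Complex.exp (-Lg w) * -(deriv G w / G w)) = 0 := by
            linear_combination (-Complex.exp (-Lg w)) * e
          exact e2 ▸ h1
        ext; simp [h2.deriv]
    intro z hz
    have := hc z hz
    rw [hL0, Complex.exp_neg, Complex.exp_neg, Complex.exp_log (hsub h00).2.2, mul_inv_cancel₀ (hsub h00).2.2] at this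
    field_simp at this
    exact this
  refine ⟨fun z => Complex.exp (s * Lg z), ?_, ?_⟩
  · intro z hz
    have hz' : z ∈ ball (0:ℂ) (δ+1) := by simp at hz ⊢; linarith
    refine DifferentiableOn.analyticAt (s := ball (0:ℂ) (δ+1)) (fun w hw => ?_) (isOpen_ball.mem_nhds hz')
    exact ((hL w hw).differentiableAt.const_mul _).cexp.differentiableWithinAt
  · intro z hz
    have hz' : z ∈ ball (0:ℂ) (δ+1) := by simp; linarith
    rw [hexp z hz', Complex.norm_exp, Complex.norm_exp, ← Real.exp_mul]
    simp [mul_comm]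


lemma s15_conv (β : ℕ → ℂ)
    (hW : Summable fun k : ℕ => ‖β k‖^2 * √((k:ℝ)+1)) :
    ∀ N : ℕ, ∑ k ∈ Finset.range N, ‖∑ x ∈ Finset.HasAntidiagonal.antidiagonal k, β x.1 * β x.2‖^2 ≤
      4 * (∑' k : ℕ, ‖β k‖^2 * √((k:ℝ)+1))^2 := by
  intro N
  set d : ℕ → ℝ := fun k => ‖β k‖^2 * √((k:ℝ)+1) with hd
  have hd0 : ∀ k, 0 ≤ d k := fun k => by simp only [hd]; positivity
  have h1 : ∀ k, ‖∑ x ∈ Finset.HasAntidiagonal.antidiagonal k, β x.1 * β x.2‖^2 ≤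
      4 * ∑ x ∈ Finset.HasAntidiagonal.antidiagonal k, d x.1 * d x.2 := by
    intro k
    have hcs := Finset.sum_sq_le_sum_mul_sum_of_sq_le_mul (Finset.HasAntidiagonal.antidiagonal k)
      (r := fun x : ℕ × ℕ => ‖β x.1‖ * ‖β x.2‖) (f := fun x => 1/(√((x.1:ℝ)+1) * √((x.2:ℝ)+1)))
      (g := fun x => d x.1 * d x.2) (fun x _ => by positivity)
      (fun x _ => mul_nonneg (hd0 _) (hd0 _)) (fun x _ => by
        simp only [hd]
        have h1 : √((x.1:ℝ)+1) ≠ 0 := by positivity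
        have h2 : √((x.2:ℝ)+1) ≠ 0 := by positivity
        refine le_of_eq ?_
        field_simp)
    have hn : ‖∑ x ∈ Finset.HasAntidiagonal.antidiagonal k, β x.1 * β x.2‖ ≤
        ∑ x ∈ Finset.HasAntidiagonal.antidiagonal k, ‖β x.1‖ * ‖β x.2‖ :=
      (norm_sum_le _ _).trans_eq (Finset.sum_congr rfl fun x _ => norm_mul _ _)
    refine (pow_le_pow_left₀ (norm_nonneg _) hn 2).trans (hcs.trans ?_)
    exact mul_le_mul_of_nonneg_right (s15_beta k)
      (Finset.sum_nonneg fun x _ => mul_nonneg (hd0 _) (hd0 _))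
  refine (Finset.sum_le_sum fun k _ => h1 k).trans ?_
  rw [← Finset.mul_sum]
  gcongr
  have hdn : Summable fun k => ‖d k‖ := hW.norm
  have h2 := summable_norm_sum_mul_antidiagonal_of_summable_norm hdn hdn
  rw [sq, tsum_mul_tsum_eq_tsum_sum_antidiagonal_of_summable_norm hdn hdn]
  refine Summable.sum_le_tsum _ (fun k _ => Finset.sum_nonneg fun x _ => mul_nonneg (hd0 _) (hd0 _)) ?_
  exact h2.of_norm

lemma s15_core (s : ℝ) (hs : 1 ≤ s) (a b : ℕ → ℂ) (h F : ℂ → ℂ)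
    (ha : Summable fun k => ‖a k‖) (hb : Summable fun k => ‖b k‖)
    (hha : ∀ z : ℂ, ‖z‖ ≤ 1 → HasSum (fun k => a k * z ^ k) (h z))
    (hFb : ∀ z : ℂ, ‖z‖ ≤ 1 → HasSum (fun k => b k * z ^ k) (F z))
    (hle : ∀ z : ℂ, ‖z‖ ≤ 1 → ‖h z‖ ≤ ‖F z‖ ^ (2 * s)) (B : ℝ)
    (hB : HasSum (fun k => ‖b k‖^2) B) (r : ℝ) (hr0 : 0 < r) (hr1 : r < 1) :
    (Summable fun k : ℕ => ‖b k‖^2 * √((k:ℝ)+1) * r^k) ∧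
    ∀ K : ℕ, ∑ k ∈ Finset.range K, ‖a k‖ * r^k ≤
      2 * B^(s-1) * (1-r)^(1/2 - s) * ∑' k : ℕ, ‖b k‖^2 * √((k:ℝ)+1) * r^k := by
  set R := √r with hR
  have hR0 : 0 < R := Real.sqrt_pos.2 hr0
  have hRr : R^2 = r := Real.sq_sqrt hr0.le
  have hR1 : R < 1 := by nlinarith
  have hB0 : 0 ≤ B := hB.nonneg fun k => by positivity
  set β : ℕ → ℂ := fun k => b k * (R:ℂ)^k with hβd
  have hpow : ∀ (c : ℕ → ℂ) k, ‖c k * (R:ℂ)^k‖^2 = ‖c k‖^2 * r^k := by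
    intro c k
    rw [norm_mul, norm_pow, Complex.norm_real, Real.norm_of_nonneg hR0.le, mul_pow, ← pow_mul,
      mul_comm k 2, pow_mul, hRr]
  have hsm : ∀ c : ℕ → ℂ, (Summable fun k => ‖c k‖) → Summable fun k => ‖c k * (R:ℂ)^k‖ := by
    intro c hc
    refine Summable.of_nonneg_of_le (fun _ => norm_nonneg _) (fun k => ?_) hc
    rw [norm_mul, norm_pow, Complex.norm_real, Real.norm_of_nonneg hR0.le]
    exact mul_le_of_le_one_right (norm_nonneg _) (pow_le_one₀ hR0.le hR1.le)
  have hβ : Summable fun k => ‖β k‖ := hsm b hb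
  have hW : Summable fun k : ℕ => ‖b k‖^2 * √((k:ℝ)+1) * r^k := by
    have h1 : Summable fun k : ℕ => ((k:ℝ)+1) * r^k := by
      have := (summable_pow_mul_geometric_of_norm_lt_one 1 (r := r) (by rw [Real.norm_of_nonneg hr0.le]; exact hr1)).add
        (summable_geometric_of_lt_one hr0.le hr1)
      refine this.congr fun k => ?_
      ring
    refine Summable.of_nonneg_of_le (fun k => by positivity) (fun k => ?_) (h1.mul_left B)
    have h2 : ‖b k‖^2 ≤ B := le_hasSum hB k fun _ _ => by positivity
    have h3 : √((k:ℝ)+1) ≤ (k:ℝ)+1 := by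
      rw [Real.sqrt_le_left (by positivity)]; nlinarith [(Nat.cast_nonneg k : (0:ℝ) ≤ k)]
    rw [← mul_assoc]
    gcongr
  refine ⟨hW, fun K => ?_⟩
  set W := ∑' k : ℕ, ‖b k‖^2 * √((k:ℝ)+1) * r^k with hWd
  have hW0 : 0 ≤ W := tsum_nonneg fun k => by positivity
  have hWβ : (fun k : ℕ => ‖β k‖^2 * √((k:ℝ)+1)) = fun k : ℕ => ‖b k‖^2 * √((k:ℝ)+1) * r^k := by
    ext k; rw [hβd]; simp only; rw [hpow b]; ring
  -- pointwise bound
  have hpt : ∀ z : ℂ, ‖z‖ = 1 → ‖F (R * z)‖^2 ≤ B / (1-r) := by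
    intro z hz
    have hn : ‖(R:ℂ) * z‖ = R := by rw [norm_mul, hz, mul_one, Complex.norm_real, Real.norm_of_nonneg hR0.le]
    have h1 := hFb (R * z) (by rw [hn]; exact hR1.le)
    have h2 : Tendsto (fun N => ‖∑ k ∈ Finset.range N, b k * (R*z)^k‖^2) atTop (𝓝 (‖F (R*z)‖^2)) :=
      (h1.tendsto_sum_nat.norm).pow 2
    refine le_of_tendsto' h2 fun N => ?_
    have h3 : ‖∑ k ∈ Finset.range N, b k * (R*z)^k‖ ≤ ∑ k ∈ Finset.range N, ‖b k‖ * R^k := by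
      refine (norm_sum_le _ _).trans_eq (Finset.sum_congr rfl fun k _ => ?_)
      rw [norm_mul, norm_pow, hn]
    refine (pow_le_pow_left₀ (norm_nonneg _) h3 2).trans ?_
    refine (Finset.sum_mul_sq_le_sq_mul_sq _ _ _).trans ?_
    rw [div_eq_mul_inv]
    gcongr
    · exact sum_le_hasSum _ (fun _ _ => by positivity) hB
    · have : ∀ k ∈ Finset.range N, (R^k)^2 = r^k := fun k _ => by rw [← pow_mul, mul_comm, pow_mul, hRr]
      rw [Finset.sum_congr rfl this]
      exact sum_le_hasSum _ (fun _ _ => by positivity) (hasSum_geometric_of_lt_one hr0.le hr1)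
  have hnR : ∀ z : ℂ, ‖z‖ = 1 → ‖(R:ℂ) * z‖ ≤ 1 := by
    intro z hz
    rw [norm_mul, hz, mul_one, Complex.norm_real, Real.norm_of_nonneg hR0.le]; exact hR1.le
  -- Parseval for h
  have hPh := s15_parseval (fun k => a k * (R:ℂ)^k) (hsm a ha) (fun z => h (R*z)) (fun z hz => by
    have := hha (R*z) (hnR z hz)
    simpa only [mul_pow, mul_assoc] using this)
  have hFβ : ∀ z : ℂ, ‖z‖ = 1 → HasSum (fun k => β k * z^k) (F (R*z)) := fun z hz => by
    have := hFb (R*z) (hnR z hz)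
    simpa only [mul_pow, mul_assoc, hβd] using this
  set c : ℕ → ℂ := fun k => ∑ x ∈ Finset.HasAntidiagonal.antidiagonal k, β x.1 * β x.2 with hc
  have hcs : Summable fun k => ‖c k‖ := summable_norm_sum_mul_antidiagonal_of_summable_norm hβ hβ
  have hPF := s15_parseval c hcs (fun z => F (R*z)^2) (fun z hz => by
    have hz1 : Summable fun k => ‖β k * z^k‖ := by simpa [hz] using hβ
    have h1 := tsum_mul_tsum_eq_tsum_sum_antidiagonal_of_summable_norm hz1 hz1
    have h2 := (summable_norm_sum_mul_antidiagonal_of_summable_norm hz1 hz1).of_norm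
    have h3 := h2.hasSum
    rw [← h1, (hFβ z hz).tsum_eq, ← sq] at h3
    refine (show (fun k => c k * z^k) = _ from funext fun k => ?_) ▸ h3
    simp only [hc, Finset.sum_mul]
    refine Finset.sum_congr rfl fun x hx => ?_
    have : x.1 + x.2 = k := by simpa using hx
    rw [← this, pow_add]; ring)
  have hcW : Real.circleAverage (fun z => ‖F (R*z)^2‖^2) 0 1 ≤ 4 * W^2 := by
    refine le_of_tendsto' hPF.tendsto_sum_nat fun N => ?_
    have := s15_conv β (by rw [hWβ]; exact hW) N
    rwa [hWβ] at this
  -- comparison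
  set Q := (B/(1-r))^(2*s-2) with hQ
  have hcontF : ContinuousOn (fun z : ℂ => F (R*z)) (sphere 0 1) := by
    have : ContinuousOn (fun z : ℂ => ∑' k, β k * z^k) (sphere 0 1) := by
      refine continuousOn_tsum (fun k => by fun_prop) hβ (fun k z hz => ?_)
      have : ‖z‖ = 1 := by simpa using hz
      simp [this]
    refine this.congr fun z hz => ?_
    exact ((hFβ z (by simpa using hz)).tsum_eq).symm
  have hconth : ContinuousOn (fun z : ℂ => h (R*z)) (sphere 0 1) := by
    have : ContinuousOn (fun z : ℂ => ∑' k, (a k * (R:ℂ)^k) * z^k) (sphere 0 1) := by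
      refine continuousOn_tsum (fun k => by fun_prop) (hsm a ha) (fun k z hz => ?_)
      have : ‖z‖ = 1 := by simpa using hz
      simp [this]
    refine this.congr fun z hz => ?_
    have := hha (R*z) (hnR z (by simpa using hz))
    rw [← this.tsum_eq]
    simp only [mul_pow, mul_assoc]
  have hcmp : Real.circleAverage (fun z => ‖h (R*z)‖^2) 0 1 ≤ Q * (4 * W^2) := by
    refine le_trans ?_ (mul_le_mul_of_nonneg_left hcW (Real.rpow_nonneg (div_nonneg hB0 (by linarith)) _))
    rw [← smul_eq_mul, ← Real.circleAverage_fun_smul]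
    refine Real.circleAverage_mono ?_ ?_ ?_
    · refine ContinuousOn.circleIntegrable' ?_
      simp only [abs_one]
      exact hconth.norm.pow 2
    · refine ContinuousOn.circleIntegrable' ?_
      simp only [abs_one]
      exact ((hcontF.pow 2).norm.pow 2).const_smul Q
    · intro z hz
      have hz1 : ‖z‖ = 1 := by simpa using hz
      have h1 := hle (R*z) (hnR z hz1)
      set X := ‖F (R*z)‖ with hX
      have hX0 : 0 ≤ X := norm_nonneg _
      have h2 : ‖h (R*z)‖^2 ≤ (X^(2*s))^2 := pow_le_pow_left₀ (norm_nonneg _) h1 2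
      refine h2.trans ?_
      simp only [smul_eq_mul, norm_pow]
      rw [← hX]
      have e : (X^(2*s))^2 = (X^2)^(2*s-2) * (X^2)^2 := by
        rw [← Real.rpow_natCast (X^2) 2, ← Real.rpow_add_of_nonneg (by positivity) (by linarith) (by norm_num),
          ← Real.rpow_natCast X 2, ← Real.rpow_mul hX0, ← Real.rpow_natCast, ← Real.rpow_mul hX0]
        congr 1; push_cast; ring
      rw [e]
      gcongr
      exact Real.rpow_le_rpow (by positivity) (hpt z hz1) (by linarith)
  -- conclusion
  have hfin : (∑ k ∈ Finset.range K, ‖a k‖ * r^k)^2 ≤ (Q * (4 * W^2)) * (1-r)⁻¹ := by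
    have e : ∀ k, ‖a k‖ * r^k = ‖a k * (R:ℂ)^k‖ * R^k := by
      intro k
      rw [norm_mul, norm_pow, Complex.norm_real, Real.norm_of_nonneg hR0.le, mul_assoc, ← pow_add, ← two_mul, pow_mul, hRr]
    simp only [e]
    refine (Finset.sum_mul_sq_le_sq_mul_sq _ _ _).trans ?_
    gcongr
    · exact (sum_le_hasSum _ (fun _ _ => by positivity) hPh).trans hcmp
    · have : ∀ k ∈ Finset.range K, (R^k)^2 = r^k := fun k _ => by rw [← pow_mul, mul_comm, pow_mul, hRr]
      rw [Finset.sum_congr rfl this]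
      exact sum_le_hasSum _ (fun _ _ => by positivity) (hasSum_geometric_of_lt_one hr0.le hr1)
  have h1r : 0 < 1 - r := by linarith
  refine le_of_sq_le_sq (hfin.trans_eq ?_) (by positivity)
  rw [hQ, Real.div_rpow hB0 h1r.le, mul_pow, mul_pow, mul_pow, ← Real.rpow_natCast (B^(s-1)), ← Real.rpow_mul hB0,
    ← Real.rpow_natCast ((1-r)^(1/2-s)), ← Real.rpow_mul h1r.le]
  have e1 : (s-1) * ((2:ℕ):ℝ) = 2*s-2 := by push_cast; ring
  have e2 : (1/2-s) * ((2:ℕ):ℝ) = -(2*s-2) + -1 := by push_cast; ring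
  rw [e1, e2, Real.rpow_add h1r, Real.rpow_neg h1r.le, Real.rpow_neg_one]
  ring


lemma s15_moment (s : ℝ) (hs : 0 < s) (μ : Measure ℝ) (hcar : IsCarleson μ s) :
    ∃ C > 0, ∀ m : ℕ, ∫ t in Ico (0:ℝ) 1, t ^ m ∂μ ≤
      C * ∑' j : ℕ, ((1/4:ℝ)^s)^j * (1 - (1/4:ℝ)^(j+1))^m := by
  obtain ⟨C, hC, hcar⟩ := hcar
  refine ⟨C, hC, fun m => ?_⟩
  have hq0 : 0 < (1/4:ℝ)^s := by positivity
  have hq1 : (1/4:ℝ)^s < 1 := Real.rpow_lt_one (by norm_num) (by norm_num) hs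
  have hr0 : ∀ j : ℕ, 0 ≤ 1 - (1/4:ℝ)^(j+1) := fun j => by
    have : (1/4:ℝ)^(j+1) ≤ 1 := pow_le_one₀ (by norm_num) (by norm_num)
    linarith
  have hr1 : ∀ j : ℕ, 1 - (1/4:ℝ)^(j+1) ≤ 1 := fun j => by
    have : 0 < (1/4:ℝ)^(j+1) := by positivity
    linarith
  have hterm : ∀ j : ℕ, 0 ≤ ((1/4:ℝ)^s)^j * (1 - (1/4:ℝ)^(j+1))^m := fun j =>
    mul_nonneg (by positivity) (pow_nonneg (hr0 j) _)
  have hsum : Summable fun j : ℕ => ((1/4:ℝ)^s)^j * (1 - (1/4:ℝ)^(j+1))^m := by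
    refine Summable.of_nonneg_of_le hterm (fun j => ?_) (summable_geometric_of_lt_one hq0.le hq1)
    exact mul_le_of_le_one_right (by positivity) (pow_le_one₀ (hr0 j) (hr1 j))
  by_cases hint : IntegrableOn (fun t : ℝ => t^m) (Ico (0:ℝ) 1) μ
  swap
  · rw [integral_undef hint]
    exact mul_nonneg hC.le (tsum_nonneg hterm)
  have hnn : 0 ≤ᵐ[μ.restrict (Ico (0:ℝ) 1)] fun t : ℝ => t^m := by
    filter_upwards [ae_restrict_mem measurableSet_Ico] with t ht
    exact pow_nonneg ht.1 _
  have hlt : ∫⁻ t in Ico (0:ℝ) 1, ENNReal.ofReal (t^m) ∂μ < ⊤ := by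
    have := (hasFiniteIntegral_iff_ofReal hnn).1 hint.2
    exact this
  have hmeas : ∀ u : ℝ, 0 ≤ u → u < 1 → 0 < u^m →
      μ (Ico u 1) ≤ ENNReal.ofReal (C * (1-u)^s) := by
    intro u hu0 hu1 hum
    have h1 : ENNReal.ofReal (u^m) * μ (Ico u 1) ≤ ∫⁻ t in Ico (0:ℝ) 1, ENNReal.ofReal (t^m) ∂μ := by
      rw [← setLIntegral_const]
      refine (setLIntegral_mono_ae' measurableSet_Ico (ae_of_all _ fun t ht => ?_)).trans
        (lintegral_mono_set (Ico_subset_Ico_left hu0))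
      exact ENNReal.ofReal_le_ofReal (pow_le_pow_left₀ hu0 ht.1 m)
    have h2 : μ (Ico u 1) ≠ ⊤ := by
      intro h
      rw [h, ENNReal.mul_top (by simpa using hum)] at h1
      exact absurd (h1.trans_lt hlt) (lt_irrefl _)
    rw [← ENNReal.ofReal_toReal h2]
    exact ENNReal.ofReal_le_ofReal (hcar u hu0 hu1)
  have hbd : ∀ (E : Set ℝ) (j : ℕ), MeasurableSet E → E ⊆ Ico 0 (1 - (1/4:ℝ)^(j+1)) →
      μ E ≤ ENNReal.ofReal (C * ((1/4:ℝ)^s)^j) → ∫⁻ t in E, ENNReal.ofReal (t^m) ∂μ ≤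
        ENNReal.ofReal (C * (((1/4:ℝ)^s)^j * (1 - (1/4:ℝ)^(j+1))^m)) := by
    intro E j hE hsub hμE
    have h1 : ∫⁻ t in E, ENNReal.ofReal (t^m) ∂μ ≤ ∫⁻ t in E, ENNReal.ofReal ((1 - (1/4:ℝ)^(j+1))^m) ∂μ :=
      setLIntegral_mono_ae' hE (ae_of_all _ fun t ht =>
        ENNReal.ofReal_le_ofReal (pow_le_pow_left₀ (hsub ht).1 (hsub ht).2.le m))
    refine h1.trans ?_
    rw [setLIntegral_const, ← mul_assoc, mul_comm (C * _), ENNReal.ofReal_mul (pow_nonneg (hr0 j) m)]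
    gcongr
  have hq : ∀ j : ℕ, (1 - (1 - (1/4:ℝ)^j))^s = ((1/4:ℝ)^s)^j := fun j => by
    rw [sub_sub_cancel, ← Real.rpow_natCast, ← Real.rpow_natCast, ← Real.rpow_mul (by norm_num),
      ← Real.rpow_mul (by norm_num), mul_comm]
  have hI : ∀ j : ℕ, ∫⁻ t in Ico (1 - (1/4:ℝ)^j) (1 - (1/4:ℝ)^(j+1)), ENNReal.ofReal (t^m) ∂μ ≤
        ENNReal.ofReal (C * (((1/4:ℝ)^s)^j * (1 - (1/4:ℝ)^(j+1))^m)) := by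
    intro j
    have hle1 : (1/4:ℝ)^j ≤ 1 := pow_le_one₀ (by norm_num) (by norm_num)
    have hpos : 0 < (1/4:ℝ)^j := by positivity
    by_cases hum : 0 < (1 - (1/4:ℝ)^j)^m
    · refine hbd _ j measurableSet_Ico (Ico_subset_Ico_left (by linarith)) ?_
      rw [← hq]
      exact (measure_mono (Ico_subset_Ico_right (hr1 j))).trans (hmeas _ (by linarith) (by linarith) hum)
    · have hz : (1 - (1/4:ℝ)^j)^m = 0 := le_antisymm (not_lt.1 hum) (pow_nonneg (by linarith) _)
      have hm0 : m ≠ 0 := by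
        rintro rfl
        simp at hz
      have h0 : 1 - (1/4:ℝ)^j = 0 := eq_zero_of_pow_eq_zero hz
      have hj : j = 0 := by
        by_contra hj
        have : (1/4:ℝ)^j < 1 := pow_lt_one₀ (by norm_num) (by norm_num) hj
        linarith
      rw [h0]
      have hsub : Ico (0:ℝ) (1 - (1/4:ℝ)^(j+1)) ⊆ {0} ∪ Ioo 0 (1 - (1/4:ℝ)^(j+1)) := by
        intro t ht
        rcases ht.1.eq_or_lt with h | h
        · exact Or.inl h.symm
        · exact Or.inr ⟨h, ht.2⟩
      refine (lintegral_mono_set hsub).trans ((lintegral_union_le _ _ _).trans ?_)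
      rw [lintegral_singleton, zero_pow hm0, ENNReal.ofReal_zero, zero_mul, zero_add]
      refine hbd _ j measurableSet_Ioo Ioo_subset_Ico_self ?_
      have hmono : Monotone fun i : ℕ => Ico (1/((i:ℝ)+2)) (1:ℝ) := by
        intro i k hik
        refine Ico_subset_Ico_left ?_
        have : (i:ℝ) ≤ k := by exact_mod_cast hik
        exact one_div_le_one_div_of_le (by positivity) (by linarith)
      have hU : Ioo (0:ℝ) (1 - (1/4:ℝ)^(j+1)) ⊆ ⋃ i : ℕ, Ico (1/((i:ℝ)+2)) (1:ℝ) := by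
        intro t ht
        obtain ⟨i, hi⟩ := exists_nat_one_div_lt ht.1
        refine mem_iUnion.2 ⟨i, ?_, ht.2.trans_le (hr1 j)⟩
        refine le_trans (one_div_le_one_div_of_le (by positivity) (by linarith)) hi.le
      refine (measure_mono hU).trans ?_
      rw [hmono.measure_iUnion]
      refine iSup_le fun i => ?_
      have hi0 : 0 < 1/((i:ℝ)+2) := by positivity
      have hi1 : 1/((i:ℝ)+2) < 1 := by
        rw [div_lt_one (by positivity)]
        have : (0:ℝ) ≤ i := Nat.cast_nonneg i
        linarith
      refine (hmeas _ hi0.le hi1 (by positivity)).trans (ENNReal.ofReal_le_ofReal ?_)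
      rw [hj, pow_zero]
      exact mul_le_mul_of_nonneg_left (Real.rpow_le_one (by linarith) (by linarith) hs.le) hC.le
  have hcov : Ico (0:ℝ) 1 ⊆ ⋃ j : ℕ, Ico (1 - (1/4:ℝ)^j) (1 - (1/4:ℝ)^(j+1)) := by
    intro t ht
    obtain ⟨j, h1, h2⟩ := exists_nat_pow_near_of_lt_one (x := 1 - t) (y := (1/4:ℝ))
      (by linarith [ht.2]) (by linarith [ht.1]) (by norm_num) (by norm_num)
    exact mem_iUnion.2 ⟨j, by linarith, by linarith⟩
  have hall : ∫⁻ t in Ico (0:ℝ) 1, ENNReal.ofReal (t^m) ∂μ ≤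
      ENNReal.ofReal (C * ∑' j : ℕ, ((1/4:ℝ)^s)^j * (1 - (1/4:ℝ)^(j+1))^m) := by
    refine (lintegral_mono_set hcov).trans ((lintegral_iUnion_le _ _).trans ?_)
    rw [← tsum_mul_left, ENNReal.ofReal_tsum_of_nonneg (fun j => mul_nonneg hC.le (hterm j)) (hsum.mul_left C)]
    exact ENNReal.tsum_le_tsum hI
  rw [integral_eq_lintegral_of_nonneg_ae hnn hint.1]
  exact ENNReal.toReal_le_of_le_ofReal (mul_nonneg hC.le (tsum_nonneg hterm)) hall

lemma s15_rho (p : ℝ) (hp0 : 0 < p) (hp1 : p ≤ 1) (h : ℂ → ℂ) (a : ℕ → ℂ)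
    (hh : AnalyticOnNhd ℂ h (closedBall 0 1))
    (hz : (∀ z : ℂ, ‖z‖ = 1 → h z ≠ 0) ∨ ∀ z : ℂ, ‖z‖ ≤ 1 → h z = 0)
    (ha : Summable fun k => ‖a k‖)
    (hha : ∀ z : ℂ, ‖z‖ ≤ 1 → HasSum (fun k => a k * z ^ k) (h z)) (J K : ℕ) :
    ∑ j ∈ Finset.range J, ((1/4:ℝ)^(1/p))^j * ∑ k ∈ Finset.range K, ‖a k‖ * (1 - (1/4:ℝ)^(j+1))^k ≤
      24 * (1/4:ℝ)^(1/2 - 1/p) * (Real.circleAverage (fun z => ‖h z‖^p) 0 1)^(1/p) := by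
  obtain ⟨F, hF, hle, heq⟩ : ∃ F : ℂ → ℂ, AnalyticOnNhd ℂ F (closedBall 0 1) ∧
      (∀ z : ℂ, ‖z‖ ≤ 1 → ‖h z‖ ≤ ‖F z‖ ^ (2 * (1/p))) ∧
      (∀ z : ℂ, ‖z‖ = 1 → ‖F z‖^2 = ‖h z‖^p) := by
    rcases hz with hz | hz
    · obtain ⟨G, hG, hG0, hhG, hhG'⟩ := s15_factor h hh hz
      obtain ⟨F, hF, hFG⟩ := s15_root G hG hG0 (p/2)
      refine ⟨F, hF, fun z hz => ?_, fun z hz => ?_⟩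
      · rw [hFG z hz, ← Real.rpow_mul (norm_nonneg _)]
        have : p/2 * (2 * (1/p)) = 1 := by field_simp
        rw [this, Real.rpow_one]
        exact hhG z hz
      · rw [hFG z hz.le, hhG' z hz, ← Real.rpow_natCast, ← Real.rpow_mul (norm_nonneg _)]
        congr 1; push_cast; ring
    · refine ⟨fun _ => 0, fun _ _ => analyticAt_const, fun z h1 => ?_, fun z h1 => ?_⟩
      · rw [hz z h1]; simp; positivity
      · rw [hz z h1.le]; simp [Real.zero_rpow hp0.ne']
  obtain ⟨b, hb, hFb⟩ := s15_series F hF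
  have hB := s15_parseval b hb F (fun z hz => hFb z hz.le)
  have hBe : Real.circleAverage (fun z => ‖F z‖^2) 0 1 = Real.circleAverage (fun z => ‖h z‖^p) 0 1 := by
    refine Real.circleAverage_congr_sphere fun z hz => ?_
    exact heq z (by simpa using hz)
  rw [hBe] at hB
  set B := Real.circleAverage (fun z => ‖h z‖^p) 0 1 with hBd
  have hB0 : 0 ≤ B := hB.nonneg fun k => by positivity
  set s := 1/p with hs
  have hs1 : 1 ≤ s := by rw [hs, le_div_iff₀ hp0]; linarith
  have hr0 : ∀ j : ℕ, 0 < 1 - (1/4:ℝ)^(j+1) := fun j => by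
    have : (1/4:ℝ)^(j+1) < 1 := pow_lt_one₀ (by norm_num) (by norm_num) (by simp)
    linarith
  have hr1 : ∀ j : ℕ, 1 - (1/4:ℝ)^(j+1) < 1 := fun j => by
    have : 0 < (1/4:ℝ)^(j+1) := by positivity
    linarith
  have core := fun j => s15_core s hs1 a b h F ha hb hha hFb hle B hB _ (hr0 j) (hr1 j)
  set D := 2 * B^(s-1) * (1/4:ℝ)^(1/2 - s) with hD
  have hD0 : 0 ≤ D := by positivity
  have e : ∀ j : ℕ, ((1/4:ℝ)^s)^j * (1 - (1 - (1/4:ℝ)^(j+1)))^(1/2-s) = (1/4:ℝ)^(1/2-s) * (1/2)^j := by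
    intro j
    have h4 : (1/2:ℝ) = (1/4:ℝ)^(1/2:ℝ) := by
      rw [← Real.sqrt_eq_rpow, eq_comm, Real.sqrt_eq_iff_mul_self_eq] <;> norm_num
    conv_rhs => rw [h4]
    rw [sub_sub_cancel]
    simp only [← Real.rpow_natCast]
    rw [← Real.rpow_mul (by norm_num), ← Real.rpow_mul (by norm_num), ← Real.rpow_mul (by norm_num),
      ← Real.rpow_add (by norm_num), ← h4, ← Real.rpow_add (by norm_num)]
    congr 1; push_cast; ring
  have step : ∀ j ∈ Finset.range J, ((1/4:ℝ)^s)^j * ∑ k ∈ Finset.range K, ‖a k‖ * (1 - (1/4:ℝ)^(j+1))^k ≤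
      D * ∑' k : ℕ, ‖b k‖^2 * ((1/2:ℝ)^j * √((k:ℝ)+1) * (1 - (1/4:ℝ)^(j+1))^k) := by
    intro j _
    have h1 := mul_le_mul_of_nonneg_left ((core j).2 K) (show 0 ≤ ((1/4:ℝ)^s)^j by positivity)
    refine h1.trans_eq ?_
    have h2 : ∀ k : ℕ, ‖b k‖^2 * ((1/2:ℝ)^j * √((k:ℝ)+1) * (1 - (1/4:ℝ)^(j+1))^k) =
      (1/2:ℝ)^j * (‖b k‖^2 * √((k:ℝ)+1) * (1 - (1/4:ℝ)^(j+1))^k) := fun k => by ring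
    simp only [h2]
    rw [tsum_mul_left, hD]
    linear_combination 2 * B^(s-1) * (∑' k : ℕ, ‖b k‖^2 * √((k:ℝ)+1) * (1 - (1/4:ℝ)^(j+1))^k) * e j
  refine (Finset.sum_le_sum step).trans ?_
  have hsm : ∀ j ∈ Finset.range J, Summable fun k : ℕ => ‖b k‖^2 * ((1/2:ℝ)^j * √((k:ℝ)+1) * (1 - (1/4:ℝ)^(j+1))^k) := by
    intro j _
    exact ((core j).1.mul_left ((1/2:ℝ)^j)).congr fun k => by ring
  rw [← Finset.mul_sum, ← Summable.tsum_finsetSum hsm]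
  have h3 : ∑' k : ℕ, ∑ j ∈ Finset.range J, ‖b k‖^2 * ((1/2:ℝ)^j * √((k:ℝ)+1) * (1 - (1/4:ℝ)^(j+1))^k) ≤ B * 12 := by
    have h4 := hB.mul_right 12
    rw [← h4.tsum_eq]
    refine Summable.tsum_le_tsum (fun k => ?_) (summable_sum hsm) h4.summable
    rw [← Finset.mul_sum]
    exact mul_le_mul_of_nonneg_left (s15_geo k J) (by positivity)
  refine (mul_le_mul_of_nonneg_left h3 hD0).trans_eq ?_
  have h5 : B^s = B^(s-1) * B := by
    conv_rhs => rw [← Real.rpow_one B, ← Real.rpow_mul hB0, one_mul]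
    rw [← Real.rpow_add_of_nonneg hB0 (by linarith) zero_le_one, sub_add_cancel]
  rw [h5, hD]; ring

lemma s15_good (f : ℂ → ℂ) (hf : DifferentiableOn ℂ f (ball (0:ℂ) 1)) (r : ℝ) (hr0 : 0 ≤ r) (hr : r < 1) :
    ∃ ρ : ℝ, r < ρ ∧ ρ < 1 ∧ ((∀ z : ℂ, ‖z‖ = ρ → f z ≠ 0) ∨ ∀ z : ℂ, ‖z‖ ≤ ρ → f z = 0) := by
  have hA : AnalyticOnNhd ℂ f (ball (0:ℂ) 1) := hf.analyticOnNhd isOpen_ball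
  rcases hA.eqOn_zero_or_eventually_ne_zero_of_preconnected (convex_ball (0:ℂ) 1).isPreconnected with h | h
  · obtain ⟨ρ, h1, h2⟩ := exists_between hr
    refine ⟨ρ, h1, h2, Or.inr fun z hz => ?_⟩
    exact h (by simpa using hz.trans_lt h2)
  · have hc : ({z | f z ≠ 0}ᶜ ∩ ball (0:ℂ) 1).Countable := by
      apply (HereditarilyLindelofSpace.isLindelof _).countable_of_isDiscrete
      exact isDiscrete_of_codiscreteWithin (by simpa using! h)
    have hc2 : ((fun z : ℂ => ‖z‖) '' ({z | f z ≠ 0}ᶜ ∩ ball (0:ℂ) 1)).Countable := hc.image _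
    have hne : ¬ (Ioo r 1 ⊆ ((fun z : ℂ => ‖z‖) '' ({z | f z ≠ 0}ᶜ ∩ ball (0:ℂ) 1))) := by
      intro hsub
      have := hc2.mono hsub
      have h3 := (Cardinal.le_aleph0_iff_set_countable.2 this)
      rw [Cardinal.mk_Ioo_real hr] at h3
      exact absurd h3 (not_le.2 Cardinal.aleph0_lt_continuum)
    obtain ⟨ρ, hρ, hρn⟩ := not_subset.1 hne
    refine ⟨ρ, hρ.1, hρ.2, Or.inl fun z hz h0 => hρn ⟨z, ⟨by simpa using h0, ?_⟩, hz⟩⟩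
    simpa [hz] using hρ.2

lemma s15_dil (p : ℝ) (hp0 : 0 < p) (hp1 : p ≤ 1) (f : ℂ → ℂ) (a : ℕ → ℂ) (hf : MemHp p f)
    (ha : ∀ z ∈ ball (0:ℂ) 1, HasSum (fun k : ℕ => a k * z ^ k) (f z)) (C : ℝ) (hC : 0 < C)
    (w : ℕ → ℝ) (hw : ∀ m : ℕ, w m ≤ C * ∑' j : ℕ, ((1/4:ℝ)^(1/p))^j * (1 - (1/4:ℝ)^(j+1))^m)
    (n K : ℕ) (ρ : ℝ) (hρ0 : 0 < ρ) (hρ1 : ρ < 1)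
    (hgood : (∀ z : ℂ, ‖z‖ = ρ → f z ≠ 0) ∨ ∀ z : ℂ, ‖z‖ ≤ ρ → f z = 0) :
    ∑ k ∈ Finset.range K, w (n+k) * (‖a k‖ * ρ^k) ≤ C * (24 * (1/4:ℝ)^(1/2 - 1/p)) * hardyNorm p f := by
  have hn : ∀ z : ℂ, ‖(ρ:ℂ) * z‖ = ρ * ‖z‖ := fun z => by
    rw [norm_mul, Complex.norm_real, Real.norm_of_nonneg hρ0.le]
  have hh : AnalyticOnNhd ℂ (fun z => f ((ρ:ℂ) * z)) (closedBall 0 1) := by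
    have hA : AnalyticOnNhd ℂ f (ball (0:ℂ) 1) := hf.1.analyticOnNhd isOpen_ball
    intro z hz
    have hz1 : ‖z‖ ≤ 1 := by simpa using hz
    have : AnalyticAt ℂ f ((ρ:ℂ) * z) := hA _ (by
      rw [mem_ball_zero_iff, hn]
      nlinarith)
    exact this.fun_comp (f := fun z : ℂ => (ρ:ℂ) * z) (by fun_prop)
  have hnorm : ∀ k, ‖a k * (ρ:ℂ)^k‖ = ‖a k‖ * ρ^k := fun k => by
    rw [norm_mul, norm_pow, Complex.norm_real, Real.norm_of_nonneg hρ0.le]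
  have hsum : Summable fun k => ‖a k * (ρ:ℂ)^k‖ :=
    (ha (ρ:ℂ) (by simpa [abs_of_pos hρ0] using hρ1)).summable.norm
  have R := s15_rho p hp0 hp1 (fun z => f ((ρ:ℂ) * z)) (fun k => a k * (ρ:ℂ)^k) hh
    (by
      rcases hgood with h | h
      · exact Or.inl fun z hz => h _ (by rw [hn, hz, mul_one])
      · exact Or.inr fun z hz => h _ (by rw [hn]; nlinarith))
    hsum (fun z hz => by
      have := ha ((ρ:ℂ) * z) (by rw [mem_ball_zero_iff, hn]; nlinarith)
      have e : (fun k : ℕ => a k * (ρ:ℂ)^k * z^k) = fun k => a k * ((ρ:ℂ) * z)^k := by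
        funext k
        rw [mul_pow, mul_assoc]
      rw [e]
      exact this)
  simp only [hnorm] at R
  have hmem : (Real.circleAverage (fun z => ‖f ((ρ:ℂ) * z)‖^p) 0 1)^(1/p) ≤ hardyNorm p f := by
    refine le_csSup hf.2 ⟨ρ, hρ0, hρ1, ?_⟩
    simp [Real.circleAverage, circleMap]
  have hr0 : ∀ j : ℕ, 0 ≤ 1 - (1/4:ℝ)^(j+1) := fun j => by
    have : (1/4:ℝ)^(j+1) ≤ 1 := pow_le_one₀ (by norm_num) (by norm_num)
    linarith
  have hr1 : ∀ j : ℕ, 1 - (1/4:ℝ)^(j+1) ≤ 1 := fun j => by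
    have : 0 < (1/4:ℝ)^(j+1) := by positivity
    linarith
  have hq0 : 0 < (1/4:ℝ)^(1/p) := by positivity
  have hq1 : (1/4:ℝ)^(1/p) < 1 := Real.rpow_lt_one (by norm_num) (by norm_num) (by positivity)
  have hsm : ∀ m : ℕ, Summable fun j : ℕ => ((1/4:ℝ)^(1/p))^j * (1 - (1/4:ℝ)^(j+1))^m := fun m => by
    refine Summable.of_nonneg_of_le (fun j => mul_nonneg (by positivity) (pow_nonneg (hr0 j) _))
      (fun j => ?_) (summable_geometric_of_lt_one hq0.le hq1)
    exact mul_le_of_le_one_right (by positivity) (pow_le_one₀ (hr0 j) (hr1 j))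
  have hw2 : ∀ k, w (n+k) ≤ C * ∑' j : ℕ, ((1/4:ℝ)^(1/p))^j * (1 - (1/4:ℝ)^(j+1))^k := fun k => by
    refine (hw (n+k)).trans (mul_le_mul_of_nonneg_left ?_ hC.le)
    refine Summable.tsum_le_tsum (fun j => ?_) (hsm _) (hsm _)
    exact mul_le_mul_of_nonneg_left (pow_le_pow_of_le_one (hr0 j) (hr1 j) (by omega)) (by positivity)
  calc ∑ k ∈ Finset.range K, w (n+k) * (‖a k‖ * ρ^k)
      ≤ ∑ k ∈ Finset.range K, C * ∑' j : ℕ, ((1/4:ℝ)^(1/p))^j * (‖a k‖ * ρ^k * (1 - (1/4:ℝ)^(j+1))^k) := by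
        refine Finset.sum_le_sum fun k _ => ?_
        refine (mul_le_mul_of_nonneg_right (hw2 k) (by positivity)).trans_eq ?_
        rw [mul_assoc, ← tsum_mul_right]
        congr 1
        exact tsum_congr fun j => by ring
    _ = C * ∑' j : ℕ, ((1/4:ℝ)^(1/p))^j * ∑ k ∈ Finset.range K, ‖a k‖ * ρ^k * (1 - (1/4:ℝ)^(j+1))^k := by
        rw [← Finset.mul_sum, ← Summable.tsum_finsetSum (fun k _ => ?_)]
        · simp only [Finset.mul_sum]
        · exact ((hsm k).mul_left (‖a k‖ * ρ^k)).congr fun j => by ring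
    _ ≤ C * (24 * (1/4:ℝ)^(1/2 - 1/p) * hardyNorm p f) := by
        refine mul_le_mul_of_nonneg_left ?_ hC.le
        refine Real.tsum_le_of_sum_range_le (fun j => mul_nonneg (by positivity)
          (Finset.sum_nonneg fun k _ => mul_nonneg (by positivity) (pow_nonneg (hr0 j) _))) fun J => ?_
        exact (R J K).trans (mul_le_mul_of_nonneg_left hmem (by positivity))
    _ = _ := by ring

/-- For `0<p≤1`, `α>0`, and `μ` a `1/p`-Carleson measure on `[0,1)`,
there is `C>0` such that for every `f(z)=Σ a_k z^k ∈ H^p` and every `n`,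
`Σ_k |μ_{n,k,α}||a_k| ≤ C (Γ(n+α)/(n!Γ(α))) ‖f‖_{H^p}`. -/
theorem stmt15 (p α : ℝ) (hp0 : 0 < p) (hp1 : p ≤ 1) (hα : 0 < α)
    (μ : Measure ℝ) (hμsupp : μ (Ico (0:ℝ) 1)ᶜ = 0)
    (hcar : IsCarleson μ (1 / p)) :
    ∃ C > 0, ∀ (f : ℂ → ℂ) (a : ℕ → ℂ), MemHp p f →
      (∀ z ∈ ball (0:ℂ) 1, HasSum (fun k : ℕ => a k * z ^ k) (f z)) →
      ∀ n : ℕ, Summable (fun k : ℕ => |muCoef μ α n k| * ‖a k‖) ∧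
        ∑' k : ℕ, |muCoef μ α n k| * ‖a k‖ ≤
          C * (Real.Gamma (n + α) / (n.factorial * Real.Gamma α)) * hardyNorm p f := by
  obtain ⟨C, hC, hw⟩ := s15_moment (1/p) (by positivity) μ hcar
  refine ⟨C * (24 * (1/4:ℝ)^(1/2 - 1/p)), by positivity, fun f a hf ha n => ?_⟩
  have hγ : 0 ≤ Real.Gamma (n + α) / (n.factorial * Real.Gamma α) := by
    have h1 : 0 < Real.Gamma (n + α) := Real.Gamma_pos_of_pos (by positivity)
    have h2 : 0 < Real.Gamma α := Real.Gamma_pos_of_pos hα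
    positivity
  set γ := Real.Gamma (n + α) / (n.factorial * Real.Gamma α) with hγd
  have hw0 : ∀ m : ℕ, 0 ≤ ∫ t in Ico (0:ℝ) 1, t ^ m ∂μ := fun m =>
    setIntegral_nonneg measurableSet_Ico fun t ht => pow_nonneg ht.1 m
  have habs : ∀ k, |muCoef μ α n k| = γ * ∫ t in Ico (0:ℝ) 1, t ^ (n+k) ∂μ := fun k => by
    rw [muCoef, abs_of_nonneg (mul_nonneg hγ (hw0 _))]
  have hK : ∀ K : ℕ, ∑ k ∈ Finset.range K, (∫ t in Ico (0:ℝ) 1, t ^ (n+k) ∂μ) * ‖a k‖ ≤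
      C * (24 * (1/4:ℝ)^(1/2 - 1/p)) * hardyNorm p f := by
    intro K
    have hr : ∀ i : ℕ, ∃ ρ : ℝ, 1 - 1/((i:ℝ)+1) < ρ ∧ ρ < 1 ∧
        ((∀ z : ℂ, ‖z‖ = ρ → f z ≠ 0) ∨ ∀ z : ℂ, ‖z‖ ≤ ρ → f z = 0) := fun i => by
      have h1 : 1/((i:ℝ)+1) ≤ 1 := by
        rw [div_le_one (by positivity)]
        have : (0:ℝ) ≤ i := Nat.cast_nonneg i
        linarith
      have h2 : 0 < 1/((i:ℝ)+1) := by positivity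
      exact s15_good f hf.1 _ (by linarith) (by linarith)
    choose ρ h1 h2 h3 using hr
    have hρ0 : ∀ i, 0 < ρ i := fun i => by
      refine lt_of_le_of_lt ?_ (h1 i)
      have : 1/((i:ℝ)+1) ≤ 1 := by
        rw [div_le_one (by positivity)]
        have : (0:ℝ) ≤ i := Nat.cast_nonneg i
        linarith
      linarith
    have hlim : Tendsto ρ atTop (𝓝 1) := by
      refine tendsto_of_tendsto_of_tendsto_of_le_of_le ?_ tendsto_const_nhds (fun i => (h1 i).le) (fun i => (h2 i).le)
      simpa using (tendsto_const_nhds (x := (1:ℝ))).sub (tendsto_one_div_add_atTop_nhds_zero_nat (𝕜 := ℝ))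
    have hcont : Continuous fun x : ℝ => ∑ k ∈ Finset.range K,
        (∫ t in Ico (0:ℝ) 1, t ^ (n+k) ∂μ) * (‖a k‖ * x^k) := by fun_prop
    have hl := (hcont.tendsto 1).comp hlim
    simp only [one_pow, mul_one] at hl
    exact le_of_tendsto' hl fun i => s15_dil p hp0 hp1 f a hf ha C hC
      (fun m => ∫ t in Ico (0:ℝ) 1, t ^ m ∂μ) hw n K (ρ i) (hρ0 i) (h2 i) (h3 i)
  have hnn : ∀ k, 0 ≤ |muCoef μ α n k| * ‖a k‖ := fun k => by positivity
  have hfin : ∀ K, ∑ k ∈ Finset.range K, |muCoef μ α n k| * ‖a k‖ ≤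
      C * (24 * (1/4:ℝ)^(1/2 - 1/p)) * γ * hardyNorm p f := fun K => by
    have := mul_le_mul_of_nonneg_left (hK K) hγ
    simp only [habs, mul_assoc] at this ⊢
    rw [← Finset.mul_sum]
    refine this.trans_eq (by ring)
  exact ⟨summable_of_sum_range_le hnn hfin, Real.tsum_le_of_sum_range_le hnn hfin⟩
end
end

section
/- Let 0<p<∞ and α>1, and let μ be a positive Borel measure on [0,1) such that ∫_{[0,1)} |f(t)| dμ(t) < ∞ for every f∈H^p (in particular, μ satisfying condition (T1) for the exponent p). Then for every 0≤r<1, every f∈H^p, and every g∈A^1_{α-2}, one has ∫_𝔻 conj(𝓗_{μ,α}(f)(rz)) g(rz) (1-|z|²)^{α-2} dA(z) = (1/(α-1)) ∫_{[0,1)} conj(f(t)) g(r²t) dμ(t), where 𝓗_{μ,α}(f)(w) = ∫_{[0,1)} f(t)/(1-tw)^α dμ(t). -/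
open MeasureTheory Complex Metric Filter Topology Set

noncomputable section

def cc (α : ℝ) (n : ℕ) : ℝ := Ring.choose (α + n - 1) n

lemma cc_mul (α : ℝ) (n : ℕ) : (n.factorial : ℝ) * cc α n = ∏ j ∈ Finset.range n, (α + j) := by
  have h := Ring.factorial_nsmul_multichoose_eq_ascPochhammer α n
  have h2 : cc α n = Ring.multichoose α n := by
    unfold cc Ring.choose
    congr 1; ring
  rw [h2, ← nsmul_eq_mul, h, Polynomial.ascPochhammer_smeval_eq_eval]
  clear h h2
  induction n with
  | zero => simp
  | succ n ih => rw [Finset.prod_range_succ, ← ih, ascPochhammer_succ_eval]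

lemma cc_hasSum (α : ℝ) {w : ℂ} (hw : ‖w‖ < 1) :
    HasSum (fun n => (cc α n : ℂ) * w ^ n) (1 / (1 - w) ^ (α : ℂ)) := by
  have h := (Complex.one_div_one_sub_cpow_hasFPowerSeriesOnBall_zero (α : ℂ)).hasSum
    (y := w) (by simpa [← ENNReal.ofReal_one, Metric.eball_ofReal] using hw)
  rw [zero_add] at h
  convert h using 2 with n
  · rfl
  · simp [cc, Complex.ofReal_choose, mul_comm]

lemma beta_int (α : ℝ) (hα : 1 < α) (n : ℕ) :
    IntegrableOn (fun s : ℝ => (Iio (1:ℝ)).indicator (fun s => s ^ n * (1 - s) ^ (α - 2)) s) (Ioi 0)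
    ∧ ∫ s in Ioi (0:ℝ), (Iio (1:ℝ)).indicator (fun s => s ^ n * (1 - s) ^ (α - 2)) s
      = n.factorial / ∏ j ∈ Finset.range (n + 1), (α - 1 + j) := by
  have h1 := Complex.betaIntegral_convergent (u := ((α - 1 : ℝ) : ℂ)) (v := (n : ℂ) + 1)
    (by simpa using hα) (by simp; positivity)
  have h2 := Complex.betaIntegral_eval_nat_add_one_right (u := ((α - 1 : ℝ) : ℂ)) (by simpa using hα) n
  rw [← Complex.betaIntegral_symm] at h2
  have h1' := Complex.betaIntegral_convergent (v := ((α - 1 : ℝ) : ℂ)) (u := (n : ℂ) + 1)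
    (by simp; positivity) (by simpa using hα)
  have key : ∀ s ∈ Ioo (0:ℝ) 1, (s : ℂ) ^ ((n : ℂ) + 1 - 1) * (1 - (s : ℂ)) ^ (((α - 1 : ℝ) : ℂ) - 1)
      = ((s ^ n * (1 - s) ^ (α - 2) : ℝ) : ℂ) := by
    intro s hs
    have : (1 : ℝ) - s ≥ 0 := by linarith [hs.2]
    rw [Complex.ofReal_mul, Complex.ofReal_cpow this]
    push_cast
    rw [add_sub_cancel_right, Complex.cpow_natCast]
    congr 2; ring
  have hIoo : Ioi (0:ℝ) ∩ Iio 1 = Ioo 0 1 := rfl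
  rw [intervalIntegrable_iff_integrableOn_Ioo_of_le zero_le_one] at h1'
  have h1'' := h1'.congr_fun key measurableSet_Ioo
  constructor
  · rw [integrableOn_indicator_iff measurableSet_Iio, Set.inter_comm, hIoo]
    exact h1''.re.congr (ae_of_all _ fun s => Complex.ofReal_re _)
  · rw [setIntegral_indicator measurableSet_Iio, hIoo]
    unfold Complex.betaIntegral at h2
    rw [intervalIntegral.integral_of_le zero_le_one, integral_Ioc_eq_integral_Ioo,
      setIntegral_congr_fun measurableSet_Ioo key, integral_complex_ofReal] at h2
    apply Complex.ofReal_injective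
    rw [h2]
    push_cast
    rfl

lemma rad_int (α : ℝ) (hα : 1 < α) (n : ℕ) :
    IntegrableOn (fun s : ℝ => s * (Iio (1:ℝ)).indicator (fun s => s ^ (2 * n) * (1 - s ^ 2) ^ (α - 2)) s) (Ioi 0)
    ∧ 2 * ∫ s in Ioi (0:ℝ), s * (Iio (1:ℝ)).indicator (fun s => s ^ (2 * n) * (1 - s ^ 2) ^ (α - 2)) s
      = n.factorial / ∏ j ∈ Finset.range (n + 1), (α - 1 + j) := by
  obtain ⟨h1, h2⟩ := beta_int α hα n
  have key : ∀ s ∈ Ioi (0:ℝ), s ^ ((2:ℝ) - 1) *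
      (Iio (1:ℝ)).indicator (fun s => s ^ n * (1 - s) ^ (α - 2)) (s ^ (2:ℝ)) =
      s * (Iio (1:ℝ)).indicator (fun s => s ^ (2 * n) * (1 - s ^ 2) ^ (α - 2)) s := by
    intro s hs
    have hs : 0 < s := hs
    have e1 : s ^ ((2:ℝ) - 1) = s := by norm_num
    rw [e1, Real.rpow_two]
    congr 1
    by_cases h : s < 1
    · rw [indicator_of_mem (by simp only [mem_Iio]; nlinarith), indicator_of_mem (by simpa using h)]
      rw [pow_mul]
    · rw [indicator_of_notMem (by simp only [mem_Iio]; nlinarith), indicator_of_notMem (by simpa using h)]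
  constructor
  · have := (integrableOn_Ioi_comp_rpow_iff' _ (two_ne_zero (α := ℝ))).2 h1
    exact this.congr_fun key measurableSet_Ioi
  · rw [← h2, ← integral_comp_rpow_Ioi
      (fun s => (Iio (1:ℝ)).indicator (fun s => s ^ n * (1 - s) ^ (α - 2)) s) (two_ne_zero (α := ℝ)), ← integral_const_mul]
    refine setIntegral_congr_fun measurableSet_Ioi fun s hs => ?_
    simp only [smul_eq_mul]
    rw [mul_assoc, key s hs]
    simp

lemma disc_eq (α : ℝ) (n : ℕ) : (ball (0:ℂ) 1).indicator (fun z => ‖z‖ ^ (2 * n) * (1 - ‖z‖ ^ 2) ^ (α - 2))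
   = fun z => (Iio (1:ℝ)).indicator (fun s => s ^ (2 * n) * (1 - s ^ 2) ^ (α - 2)) ‖z‖ := by
  ext z
  simp [indicator]

lemma disc_int (α : ℝ) (hα : 1 < α) (n : ℕ) :
    IntegrableOn (fun z : ℂ => ‖z‖ ^ (2 * n) * (1 - ‖z‖ ^ 2) ^ (α - 2)) (ball 0 1)
    ∧ ∫ z in ball (0:ℂ) 1, ‖z‖ ^ (2 * n) * (1 - ‖z‖ ^ 2) ^ (α - 2)
      = Real.pi * (n.factorial / ∏ j ∈ Finset.range (n + 1), (α - 1 + j)) := by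
  obtain ⟨h1, h2⟩ := rad_int α hα n
  constructor
  · rw [← integrable_indicator_iff measurableSet_ball, disc_eq]
    rw [integrable_fun_norm_addHaar]
    simpa [Complex.finrank_real_complex] using h1
  · rw [← integral_indicator measurableSet_ball, disc_eq, integral_fun_norm_addHaar, ← h2]
    simp [Complex.finrank_real_complex, Measure.real]
    ring

lemma w_int (α : ℝ) (hα : 1 < α) :
    IntegrableOn (fun z : ℂ => (1 - ‖z‖ ^ 2) ^ (α - 2)) (ball 0 1) := by
  simpa using (disc_int α hα 0).1

lemma cc_beta (α : ℝ) (hα : 1 < α) (n : ℕ) :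
    cc α n * (n.factorial / ∏ j ∈ Finset.range (n + 1), (α - 1 + j)) = (α - 1)⁻¹ := by
  have h : ∏ j ∈ Finset.range (n + 1), (α - 1 + j) = (α - 1) * ((n.factorial : ℝ) * cc α n) := by
    rw [Finset.prod_range_succ', cc_mul, mul_comm]
    congr 1
    · simp
    · refine Finset.prod_congr rfl fun j _ => ?_
      push_cast; ring
  have hp : 0 < ∏ j ∈ Finset.range (n + 1), (α - 1 + j) :=
    Finset.prod_pos fun j _ => by have : (0:ℝ) ≤ j := by positivity
                                  linarith
  rw [h] at hp ⊢
  have h3 := hp.ne'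
  have : α - 1 ≠ 0 := by linarith
  have : (n.factorial : ℝ) ≠ 0 := by positivity
  have : cc α n ≠ 0 := by rintro h; simp [h] at h3
  field_simp

lemma mono_ne (α : ℝ) (n m : ℕ) (hnm : n ≠ m) :
    ∫ z in ball (0:ℂ) 1, (starRingEnd ℂ z) ^ n * z ^ m * (((1 - ‖z‖ ^ 2) ^ (α - 2) : ℝ) : ℂ) = 0 := by
  set F : ℂ → ℂ := fun z => (starRingEnd ℂ z) ^ n * z ^ m * (((1 - ‖z‖ ^ 2) ^ (α - 2) : ℝ) : ℂ) with hF
  obtain ⟨c, hc⟩ : ∃ c : Circle, (starRingEnd ℂ (c:ℂ)) ^ n * (c:ℂ) ^ m = -1 := by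
    refine ⟨Circle.exp (Real.pi / ((m:ℝ) - n)), ?_⟩
    have hne : (m : ℂ) - n ≠ 0 := sub_ne_zero.2 (by exact_mod_cast hnm.symm)
    rw [Circle.coe_exp, ← Complex.exp_conj, ← Complex.exp_nat_mul, ← Complex.exp_nat_mul, ← Complex.exp_add,
      ← Complex.exp_pi_mul_I]
    congr 1
    simp
    field_simp
    ring
  have hmp := (rotation c).measurePreserving
  have h1 := hmp.integral_comp (rotation c).toHomeomorph.measurableEmbedding ((ball (0:ℂ) 1).indicator F)
  have h2 : ∀ z, (ball (0:ℂ) 1).indicator F (rotation c z) = - (ball (0:ℂ) 1).indicator F z := by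
    intro z
    by_cases hz : z ∈ ball (0:ℂ) 1
    · rw [indicator_of_mem hz, indicator_of_mem (by simpa [Circle.norm_coe] using hz)]
      simp only [hF, rotation_apply, map_mul, norm_mul, Circle.norm_coe, one_mul, mul_pow]
      linear_combination ((starRingEnd ℂ z) ^ n * z ^ m * (((1 - ‖z‖ ^ 2) ^ (α - 2) : ℝ) : ℂ)) * hc
    · rw [indicator_of_notMem hz, indicator_of_notMem (by simpa [Circle.norm_coe] using hz), neg_zero]
  simp_rw [h2] at h1
  rw [integral_neg, integral_indicator measurableSet_ball] at h1
  exact CharZero.neg_eq_self_iff.1 h1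

lemma mono_eq (α : ℝ) (hα : 1 < α) (n : ℕ) :
    ∫ z in ball (0:ℂ) 1, (starRingEnd ℂ z) ^ n * z ^ n * (((1 - ‖z‖ ^ 2) ^ (α - 2) : ℝ) : ℂ) =
     ((Real.pi * (n.factorial / ∏ j ∈ Finset.range (n + 1), (α - 1 + j)) : ℝ) : ℂ) := by
  rw [← (disc_int α hα n).2, ← integral_complex_ofReal]
  congr 1
  ext z
  rw [← mul_pow, mul_comm _ z, Complex.mul_conj, Complex.normSq_eq_norm_sq]
  push_cast
  rw [← pow_mul]

lemma mono_int (α : ℝ) (hα : 1 < α) (n m : ℕ) :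
    IntegrableOn (fun z : ℂ => (starRingEnd ℂ z) ^ n * z ^ m * (((1 - ‖z‖ ^ 2) ^ (α - 2) : ℝ) : ℂ)) (ball 0 1)
    ∧ ∫ z in ball (0:ℂ) 1, ‖(starRingEnd ℂ z) ^ n * z ^ m * (((1 - ‖z‖ ^ 2) ^ (α - 2) : ℝ) : ℂ)‖
      ≤ ∫ z in ball (0:ℂ) 1, (1 - ‖z‖ ^ 2) ^ (α - 2) := by
  have hw := w_int α hα
  have hb : ∀ z ∈ ball (0:ℂ) 1, ‖(starRingEnd ℂ z) ^ n * z ^ m * (((1 - ‖z‖ ^ 2) ^ (α - 2) : ℝ) : ℂ)‖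
      ≤ (1 - ‖z‖ ^ 2) ^ (α - 2) := by
    intro z hz
    have hz : ‖z‖ < 1 := by simpa using hz
    have h0 : 0 ≤ 1 - ‖z‖ ^ 2 := by nlinarith [norm_nonneg z]
    have h1 : 0 ≤ (1 - ‖z‖ ^ 2) ^ (α - 2) := Real.rpow_nonneg h0 _
    rw [norm_mul, norm_mul, norm_pow, norm_pow, RCLike.norm_conj, Complex.norm_real, Real.norm_of_nonneg h1]
    refine mul_le_of_le_one_left h1 ?_
    exact mul_le_one₀ (pow_le_one₀ (norm_nonneg _) hz.le) (by positivity) (pow_le_one₀ (norm_nonneg _) hz.le)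
  have hi : IntegrableOn (fun z : ℂ => (starRingEnd ℂ z) ^ n * z ^ m * (((1 - ‖z‖ ^ 2) ^ (α - 2) : ℝ) : ℂ)) (ball 0 1) := by
    refine Integrable.mono' hw ?_ ?_
    · refine AEStronglyMeasurable.mul ?_ ?_
      · exact (by fun_prop : Continuous fun z : ℂ => (starRingEnd ℂ z) ^ n * z ^ m).aestronglyMeasurable
      · exact (hw.ofReal (𝕜 := ℂ)).aestronglyMeasurable
    · exact (ae_restrict_iff' measurableSet_ball).2 (ae_of_all _ hb)
  exact ⟨hi, setIntegral_mono_on hi.norm hw measurableSet_ball hb⟩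

lemma repro (α : ℝ) (hα : 1 < α) (a : ℝ) (ha0 : 0 ≤ a) (ha1 : a < 1) (b : ℕ → ℂ)
    (hb : Summable fun m => ‖b m‖) (G : ℂ → ℂ)
    (hG : ∀ z ∈ ball (0:ℂ) 1, HasSum (fun m => b m * z ^ m) (G z)) :
    ∫ z in ball (0:ℂ) 1, (starRingEnd ℂ) (1 / (1 - (a:ℂ) * z) ^ (α : ℂ)) * G z *
      (((1 - ‖z‖ ^ 2) ^ (α - 2) : ℝ) : ℂ) = ((Real.pi * (α - 1)⁻¹ : ℝ) : ℂ) * G a := by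
  have ham : (a : ℂ) ∈ ball (0:ℂ) 1 := by simpa [abs_of_nonneg ha0] using ha1
  have hc : Summable fun n => ‖(cc α n : ℂ) * (a : ℂ) ^ n‖ :=
    summable_norm_iff.2 (cc_hasSum α (by simpa using ham)).summable
  let F : ℕ × ℕ → ℂ → ℂ := fun q z => ((cc α q.1 : ℂ) * (a : ℂ) ^ q.1 * b q.2) *
    ((starRingEnd ℂ z) ^ q.1 * z ^ q.2 * (((1 - ‖z‖ ^ 2) ^ (α - 2) : ℝ) : ℂ))
  have hFi : ∀ q, Integrable (F q) (volume.restrict (ball (0:ℂ) 1)) := fun q =>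
    (mono_int α hα q.1 q.2).1.const_mul _
  have hcb : Summable fun q : ℕ × ℕ => ‖(cc α q.1 : ℂ) * (a : ℂ) ^ q.1 * b q.2‖ := by
    have := Summable.mul_of_nonneg hc hb (fun _ => norm_nonneg _) (fun _ => norm_nonneg _)
    refine this.congr fun q => ?_
    rw [norm_mul (_ * _) (b q.2)]
  have hFs : Summable fun q => ∫ z in ball (0:ℂ) 1, ‖F q z‖ := by
    refine Summable.of_nonneg_of_le (fun q => integral_nonneg fun z => norm_nonneg _) (fun q => ?_)
      (hcb.mul_right (∫ z in ball (0:ℂ) 1, (1 - ‖z‖ ^ 2) ^ (α - 2)))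
    simp only [F]
    simp_rw [norm_mul (_ * b q.2)]
    rw [integral_const_mul]
    exact mul_le_mul_of_nonneg_left (mono_int α hα q.1 q.2).2 (norm_nonneg _)
  have h1 := hasSum_integral_of_summable_integral_norm hFi hFs
  have h2 : ∫ z in ball (0:ℂ) 1, ∑' q, F q z = ∫ z in ball (0:ℂ) 1,
      (starRingEnd ℂ) (1 / (1 - (a:ℂ) * z) ^ (α : ℂ)) * G z *
      (((1 - ‖z‖ ^ 2) ^ (α - 2) : ℝ) : ℂ) := by
    refine setIntegral_congr_fun measurableSet_ball fun z hz => ?_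
    have hz1 : ‖z‖ < 1 := by simpa using hz
    have haz : ‖(a:ℂ) * z‖ < 1 := by
      rw [norm_mul, Complex.norm_real, Real.norm_of_nonneg ha0]
      nlinarith [norm_nonneg z]
    have hk := (cc_hasSum α haz)
    have hk' := hk.mapL (Complex.conjCLE : ℂ →L[ℝ] ℂ)
    have hk2 : HasSum (fun n => (cc α n : ℂ) * (a : ℂ) ^ n * (starRingEnd ℂ z) ^ n)
      ((starRingEnd ℂ) (1 / (1 - (a:ℂ) * z) ^ (α : ℂ))) := by
      refine HasSum.congr_fun ?_ ?_ (f := fun n => (starRingEnd ℂ) ((cc α n : ℂ) * ((a:ℂ) * z) ^ n))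
      · exact hk'
      · intro n
        simp [mul_pow, mul_assoc]
    have hs1 := summable_norm_iff.2 hk2.summable
    have hs2 := summable_norm_iff.2 (hG z hz).summable
    have hs := summable_mul_of_summable_norm hs1 hs2
    have := (hk2.mul (hG z hz) hs).mul_right ((((1 - ‖z‖ ^ 2) ^ (α - 2) : ℝ) : ℂ))
    rw [← this.tsum_eq]
    refine tsum_congr fun q => ?_
    simp only [F]
    ring
  rw [h2] at h1
  have h3 : ∀ q : ℕ × ℕ, ∫ z in ball (0:ℂ) 1, F q z =
      if q.1 = q.2 then ((Real.pi * (α - 1)⁻¹ : ℝ) : ℂ) * (b q.2 * (a:ℂ) ^ q.2) else 0 := by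
    rintro ⟨n, m⟩
    simp only [F]
    rw [integral_const_mul]
    split_ifs with h
    · subst h
      rw [mono_eq α hα n, ← cc_beta α hα n]
      push_cast
      ring
    · rw [mono_ne α n m h, mul_zero]
  simp_rw [h3] at h1
  have h4 := (hG a ham).mul_left (((Real.pi * (α - 1)⁻¹ : ℝ) : ℂ))
  have hinj : Function.Injective (fun n : ℕ => (n, n)) := fun x y h => (Prod.mk.inj h).1
  have h5 := (hinj.hasSum_iff (f := fun q : ℕ × ℕ => if q.1 = q.2 then ((Real.pi * (α - 1)⁻¹ : ℝ) : ℂ) * (b q.2 * (a:ℂ) ^ q.2) else 0) (by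
    rintro ⟨n, m⟩ h
    rw [if_neg]
    intro h'
    exact h ⟨n, Prod.ext rfl h'⟩) (a := ((Real.pi * (α - 1)⁻¹ : ℝ) : ℂ) * G a)).1 (by simpa only [Function.comp_def, if_true] using h4)
  exact h1.unique h5

/-- For `0<p<∞`, `α>1` and `μ` with `∫_{[0,1)}|f| dμ < ∞` for all
`f ∈ H^p`, the duality identity
`∫_𝔻 conj(𝓗_{μ,α}f(rz)) g(rz)(1-|z|²)^{α-2} dA(z) = (α-1)⁻¹ ∫_{[0,1)} conj(f(t)) g(r²t) dμ(t)`
holds for all `0 ≤ r < 1`, `f ∈ H^p`, `g ∈ A^1_{α-2}`, where `𝓗_{μ,α}f` is given by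
the integral formula. -/
theorem stmt16 (p α : ℝ) (hp : 0 < p) (hα : 1 < α)
    (μ : Measure ℝ) (hμsupp : μ (Ico (0:ℝ) 1)ᶜ = 0)
    (hint : ∀ f : ℂ → ℂ, MemHp p f →
      Integrable (fun t : ℝ => f (t : ℂ)) (μ.restrict (Ico (0:ℝ) 1))) :
    ∀ r : ℝ, 0 ≤ r → r < 1 → ∀ f g : ℂ → ℂ, MemHp p f → MemBergman 1 (α - 2) g →
      (Real.pi⁻¹ : ℂ) *
          ∫ z in ball (0:ℂ) 1,
            (starRingEnd ℂ) (Iop μ α f ((r : ℂ) * z)) * g ((r : ℂ) * z) *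
              (((1 - ‖z‖ ^ 2) ^ (α - 2) : ℝ) : ℂ)
        = (((α - 1 : ℝ) : ℂ))⁻¹ *
            ∫ t in Ico (0:ℝ) 1, (starRingEnd ℂ) (f (t : ℂ)) * g (((r ^ 2 * t : ℝ) : ℂ)) ∂μ := by
  intro r hr0 hr1 f g hf hg
  have hone : MemHp p (fun _ => 1) := by
    refine ⟨differentiableOn_const _, 1, ?_⟩
    rintro y ⟨ρ, _, _, rfl⟩
    have h0 : Real.pi ≠ 0 := Real.pi_ne_zero
    have h1 : Real.pi⁻¹ * 2⁻¹ * (2 * Real.pi) = 1 := by field_simp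
    simp [h1]
  set ν := μ.restrict (Ico (0:ℝ) 1) with hν
  have hfin : IsFiniteMeasure ν := (integrable_const_iff_isFiniteMeasure one_ne_zero).1 (hint _ hone)
  have hμν : ν = μ := Measure.restrict_eq_self_of_ae_mem hμsupp
  have hsf : SFinite μ := by
    rw [← hμν]
    infer_instance
  have hfi := hint f hf
  have hw := w_int α hα
  have hrz : ∀ z ∈ ball (0:ℂ) 1, (r:ℂ) * z ∈ closedBall (0:ℂ) r := by
    intro z hz
    have hz : ‖z‖ < 1 := by simpa using hz
    rw [mem_closedBall_zero_iff, norm_mul, Complex.norm_real, Real.norm_of_nonneg hr0]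
    exact mul_le_of_le_one_right hr0 hz.le
  have hsub : closedBall (0:ℂ) r ⊆ ball (0:ℂ) 1 := closedBall_subset_ball hr1
  obtain ⟨C, hC⟩ := (isCompact_closedBall (0:ℂ) r).exists_bound_of_continuousOn
    (hg.1.continuousOn.mono hsub)
  have hC0 : 0 ≤ C := (norm_nonneg _).trans (hC 0 (by simpa using hr0))
  let K : ℂ → ℝ → ℂ := fun z t => (starRingEnd ℂ) (1 / (1 - ((r * t : ℝ) : ℂ) * z) ^ (α : ℂ)) * g ((r:ℂ) * z)
  let H : ℂ → ℝ → ℂ := fun z t => K z t * ((((1 - ‖z‖ ^ 2) ^ (α - 2) : ℝ) : ℂ) * (starRingEnd ℂ) (f t))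
  have hHint : Integrable (Function.uncurry H) ((volume.restrict (ball (0:ℂ) 1)).prod ν) := by
    have hbase : Integrable (fun q : ℂ × ℝ => (((1 - ‖q.1‖ ^ 2) ^ (α - 2) : ℝ) : ℂ) * (starRingEnd ℂ) (f q.2))
        ((volume.restrict (ball (0:ℂ) 1)).prod ν) :=
      Integrable.mul_prod (f := fun z : ℂ => (((1 - ‖z‖ ^ 2) ^ (α - 2) : ℝ) : ℂ))
        (g := fun t : ℝ => (starRingEnd ℂ) (f t)) hw.ofReal
        ((Complex.conjCLE : ℂ →L[ℝ] ℂ).integrable_comp hfi)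
    refine Integrable.bdd_mul (f := fun q : ℂ × ℝ => K q.1 q.2) (c := ((1 - r) ^ α)⁻¹ * C) hbase ?_ ?_
    · refine AEStronglyMeasurable.mul ?_ ?_
      · apply Measurable.aestronglyMeasurable
        have : Measurable fun q : ℂ × ℝ => (1 - ((r * q.2 : ℝ) : ℂ) * q.1) ^ (α : ℂ) := by
          apply Measurable.pow_const
          fun_prop
        exact Complex.continuous_conj.measurable.comp (measurable_const.div this)
      · have : AEStronglyMeasurable (fun z : ℂ => g ((r:ℂ) * z)) (volume.restrict (ball (0:ℂ) 1)) := by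
          refine ContinuousOn.aestronglyMeasurable ?_ measurableSet_ball
          exact hg.1.continuousOn.comp (by fun_prop) fun z hz => hsub (hrz z hz)
        exact this.comp_fst
    · rw [hν, Measure.prod_restrict, ae_restrict_iff' (measurableSet_ball.prod measurableSet_Ico)]
      refine ae_of_all _ ?_
      rintro ⟨z, t⟩ ⟨hz, ht⟩
      have hz' : ‖z‖ < 1 := by simpa using hz
      simp only at ht
      simp only [K]
      rw [norm_mul, RCLike.norm_conj, norm_div, norm_one, Complex.norm_cpow_real, one_div]
      have hrt : r * t ≤ r := mul_le_of_le_one_right hr0 ht.2.le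
      have hrt0 : 0 ≤ r * t := mul_nonneg hr0 ht.1
      have h1 : 1 - r ≤ ‖1 - ((r * t : ℝ) : ℂ) * z‖ := by
        have := norm_sub_norm_le (1:ℂ) (((r * t : ℝ) : ℂ) * z)
        rw [norm_one, norm_mul, Complex.norm_real, Real.norm_of_nonneg hrt0] at this
        nlinarith [norm_nonneg z]
      have h2 : (1 - r) ^ α ≤ ‖1 - ((r * t : ℝ) : ℂ) * z‖ ^ α :=
        Real.rpow_le_rpow (by linarith) h1 (by linarith)
      have h3 : 0 < (1 - r) ^ α := Real.rpow_pos_of_pos (by linarith) _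
      exact mul_le_mul (inv_anti₀ h3 h2) (hC _ (hrz z hz)) (norm_nonneg _) (by positivity)
  have hL : ∀ z : ℂ, (starRingEnd ℂ) (Iop μ α f ((r : ℂ) * z)) * g ((r : ℂ) * z) *
      (((1 - ‖z‖ ^ 2) ^ (α - 2) : ℝ) : ℂ) = ∫ t, H z t ∂ν := by
    intro z
    unfold Iop
    rw [← integral_conj, ← integral_mul_const, ← integral_mul_const]
    refine integral_congr_ae (ae_of_all _ fun t => ?_)
    have e : (t:ℂ) * ((r:ℂ) * z) = ((r * t : ℝ) : ℂ) * z := by push_cast; ring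
    simp only [H, K, e, map_div₀, map_one]
    ring
  simp_rw [hL]
  rw [integral_integral_swap hHint]
  let b : ℕ → ℂ := fun m => (m.factorial : ℂ)⁻¹ * iteratedDeriv m g 0 * (r:ℂ) ^ m
  have hT : ∀ w ∈ ball (0:ℂ) 1, HasSum (fun m : ℕ => (m.factorial : ℂ)⁻¹ * iteratedDeriv m g 0 * w ^ m) (g w) := by
    intro w hw
    have := Complex.hasSum_taylorSeries_on_ball hg.1 hw
    refine this.congr_fun fun m => ?_
    simp only [smul_eq_mul, sub_zero]
    ring
  have hb : Summable fun m => ‖b m‖ :=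
    summable_norm_iff.2 (hT r (by simpa [abs_of_nonneg hr0] using hr1)).summable
  have hG : ∀ z ∈ ball (0:ℂ) 1, HasSum (fun m => b m * z ^ m) (g ((r:ℂ) * z)) := by
    intro z hz
    refine (hT _ (hsub (hrz z hz))).congr_fun fun m => ?_
    simp only [b]
    ring
  have hR : ∀ t ∈ Ico (0:ℝ) 1, ∫ z in ball (0:ℂ) 1, H z t =
      ((Real.pi * (α - 1)⁻¹ : ℝ) : ℂ) * ((starRingEnd ℂ) (f t) * g (((r ^ 2 * t : ℝ) : ℂ))) := by
    intro t ht
    have h := repro α hα (r * t) (mul_nonneg hr0 ht.1)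
      ((mul_le_of_le_one_right hr0 ht.2.le).trans_lt hr1) b hb (fun z => g ((r:ℂ) * z)) hG
    have e : (r:ℂ) * ((r * t : ℝ) : ℂ) = ((r ^ 2 * t : ℝ) : ℂ) := by push_cast; ring
    simp only [e] at h
    calc _ = ∫ z in ball (0:ℂ) 1, ((starRingEnd ℂ) (1 / (1 - ((r * t : ℝ):ℂ) * z) ^ (α : ℂ)) * g ((r:ℂ) * z) *
      (((1 - ‖z‖ ^ 2) ^ (α - 2) : ℝ) : ℂ)) * (starRingEnd ℂ) (f t) := by
          refine integral_congr_ae (ae_of_all _ fun z => ?_)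
          simp only [H, K]
          ring
      _ = _ := by
          rw [integral_mul_const, h]
          ring
  rw [hν, setIntegral_congr_fun measurableSet_Ico hR, integral_const_mul, ← mul_assoc]
  congr 1
  have : (Real.pi : ℂ) ≠ 0 := by exact_mod_cast Real.pi_ne_zero
  push_cast
  field_simp
end
end
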